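/- arXiv:2406.07273 — 2 statements merged into one kernel-verified Lean document; each statement's English description precedes it below -/
import Mathlib

section
/- Let X be an infinite-dimensional real Banach space such that: (i) X is weakly compactly generated, i.e., there is a subset K of X that is compact in the weak topology and whose linear span is dense in X; (ii) X contains an isomorphic copy of c₀, i.e., there are a bounded linear operator S : c₀ → X and a constant c > 0 with ‖S u‖ ≥ c·‖u‖_∞ for all u ∈ c₀; and (iii) X is isomorphic to a subspace of ℓ∞, i.e., there are a bounded linear operator J : X → ℓ∞ and a constant c' > 0 with ‖J x‖_∞ ≥ c'·‖x‖ for all x ∈ X. Then there exist a real Banach space X' and a continuous linear equivalence between X and X' such that whenever f, g ∈ NA(X',ℝ) are linearly independent and 0 < t < 1, the functional t·f + (1−t)·g is not norm-attaining. -/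
open scoped ENNReal

section

open Set Filter Topology

theorem ConvexOn.comp_line {V : Type*} [AddCommGroup V] [Module ℝ V] {F : V → ℝ}
    (hF : ConvexOn ℝ univ F) (x y : V) : ConvexOn ℝ univ fun t : ℝ => F (x + t • y) := by
  refine ⟨convex_univ, fun s _ t _ a b ha hb hab => ?_⟩
  have h := hF.2 (mem_univ (x + s • y)) (mem_univ (x + t • y)) ha hb hab
  have e : x + (a • s + b • t) • y = a • (x + s • y) + b • (x + t • y) := by
    have : x = (a + b) • x := by rw [hab, one_smul]
    nth_rewrite 1 [this]
    simp only [smul_eq_mul]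
    module
  simpa only [e] using h

/-- A convex function whose symmetric second differences in a direction are `o(t)` is
differentiable in that direction. -/
theorem ConvexOn.exists_hasLineDerivAt {V : Type*} [AddCommGroup V] [Module ℝ V] {F : V → ℝ}
    (hF : ConvexOn ℝ univ F) {x y : V}
    (h : ∀ η > 0, ∃ C : ℝ, ∀ t > 0, F (x + t • y) + F (x - t • y) - 2 * F x ≤ η * t + C * t ^ 2) :
    ∃ d, HasLineDerivAt ℝ F d x y := by
  have hg := hF.comp_line x y
  set g : ℝ → ℝ := fun t => F (x + t • y) with hgdef
  have hmem : (0 : ℝ) ∈ interior (univ : Set ℝ) := by simp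
  have hR := hg.hasDerivWithinAt_rightDeriv_of_mem_interior hmem
  have hL := hg.hasDerivWithinAt_leftDeriv_of_mem_interior hmem
  have hLR := hg.leftDeriv_le_rightDeriv_of_mem_interior hmem
  set R := derivWithin g (Ioi 0) 0
  set L := derivWithin g (Iio 0) 0
  have key : ∀ η > 0, ∃ C : ℝ, ∀ t > 0, R - L ≤ η + C * t := by
    intro η hη
    obtain ⟨C, hC⟩ := h η hη
    refine ⟨C, fun t ht => ?_⟩
    have h1 : R ≤ slope g 0 t := hg.rightDeriv_le_slope_of_mem_interior hmem (mem_univ t) ht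
    have h2 : slope g (-t) 0 ≤ L :=
      hg.slope_le_leftDeriv_of_mem_interior (mem_univ _) hmem (neg_lt_zero.mpr ht)
    rw [slope_def_field] at h1 h2
    have e0 : g 0 = F x := by simp [hgdef]
    have e1 : g (-t) = F (x - t • y) := by simp [hgdef, sub_eq_add_neg]
    have e2 : g t = F (x + t • y) := rfl
    rw [e0, e1, sub_neg_eq_add, zero_add, div_le_iff₀ ht] at h2
    rw [e0, e2, sub_zero, le_div_iff₀ ht] at h1
    have := hC t ht
    have : (R - L) * t ≤ (η + C * t) * t := by nlinarith
    exact le_of_mul_le_mul_right this ht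
  have hRL : R ≤ L := by
    refine le_of_forall_pos_le_add fun η hη => ?_
    obtain ⟨C, hC⟩ := key (η / 2) (by positivity)
    have := hC (η / 2 / (|C| + 1)) (by positivity)
    have h3 : C * (η / 2 / (|C| + 1)) ≤ η / 2 := by
      have : C * (η / 2 / (|C| + 1)) = (η / 2) * (C / (|C| + 1)) := by ring
      rw [this]
      have : C / (|C| + 1) ≤ 1 := by
        rw [div_le_one (by positivity)]
        linarith [le_abs_self C]
      nlinarith
    linarith
  have hEq : L = R := le_antisymm hLR hRL
  refine ⟨R, ?_⟩
  rw [hEq] at hL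
  have hu := hL.union hR
  rw [Iio_union_Ioi] at hu
  rw [compl_eq_univ_sdiff, hasDerivWithinAt_sdiff_singleton] at hu
  exact hasDerivWithinAt_univ.mp hu

/-- If a linear functional attains its maximum over the sublevel set `{F ≤ F x}` of a convex
function `F` at `x`, then it is proportional to the directional derivative of `F` at `x`. -/
theorem LinearMap.mul_lineDeriv_eq_of_isMaxOn_sublevel {V : Type*} [AddCommGroup V] [Module ℝ V]
    {F : V → ℝ} (hF : ConvexOn ℝ univ F) {x : V} {D : V → ℝ}
    (hD : ∀ y, HasLineDerivAt ℝ F (D y) x y) (h0 : F 0 < F x) {h : V →ₗ[ℝ] ℝ}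
    (hmax : ∀ z, F z ≤ F x → h z ≤ h x) :
    0 < D x ∧ ∀ y, h y * D x = h x * D y := by
  have hsmul : ∀ (c : ℝ) y, D (c • y) = c * D y := fun c y =>
    (hD (c • y)).unique ((hD y).smul c)
  have hle : ∀ y, D y ≤ F (x + y) - F x := by
    intro y
    have := (hF.comp_line x y).le_slope_of_hasDerivAt (mem_univ 0) (mem_univ 1) one_pos (hD y)
    simpa [slope_def_field] using this
  have hadd : ∀ y z, D (y + z) ≤ D y + D z := by
    intro y z
    have h1 : Tendsto (fun t : ℝ => t⁻¹ • (F (x + t • (y + z)) - F x)) (𝓝[>] 0) (𝓝 (D (y + z))) :=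
      (hD (y + z)).tendsto_slope_zero_right
    have h2 : Tendsto (fun t : ℝ => t⁻¹ • (F (x + t • ((2 : ℝ) • y)) - F x)) (𝓝[>] 0)
        (𝓝 (D ((2 : ℝ) • y))) := (hD _).tendsto_slope_zero_right
    have h3 : Tendsto (fun t : ℝ => t⁻¹ • (F (x + t • ((2 : ℝ) • z)) - F x)) (𝓝[>] 0)
        (𝓝 (D ((2 : ℝ) • z))) := (hD _).tendsto_slope_zero_right
    rw [hsmul] at h2 h3
    have h4 := le_of_tendsto_of_tendsto h1 ((h2.add h3).const_mul (1 / 2)) (by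
      filter_upwards [self_mem_nhdsWithin] with t (ht : 0 < t)
      have := hF.2 (mem_univ (x + t • ((2 : ℝ) • y))) (mem_univ (x + t • ((2 : ℝ) • z)))
        (show (0 : ℝ) ≤ 1 / 2 by norm_num) (show (0 : ℝ) ≤ 1 / 2 by norm_num) (by norm_num)
      have e : (1 / 2 : ℝ) • (x + t • ((2 : ℝ) • y)) + (1 / 2 : ℝ) • (x + t • ((2 : ℝ) • z))
          = x + t • (y + z) := by module
      rw [e] at this
      simp only [smul_eq_mul] at this ⊢
      have ht' : 0 < t⁻¹ := inv_pos.mpr ht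
      nlinarith)
    linarith
  have hneg : ∀ y, D (-y) = -D y := fun y => by simpa using hsmul (-1) y
  have hpos : 0 < D x := by
    have := hle (-x)
    rw [hneg, add_neg_cancel] at this
    linarith
  have hdesc : ∀ z, D z < 0 → h z ≤ 0 := by
    intro z hz
    have h1 := (hD z).tendsto_slope_zero_right
    have h2 : ∀ᶠ t : ℝ in 𝓝[>] 0, t⁻¹ • (F (x + t • z) - F x) < 0 := h1.eventually_lt_const hz
    obtain ⟨t, ht, ht0⟩ := (h2.and self_mem_nhdsWithin).exists
    have ht0 : 0 < t := ht0
    have h3 : F (x + t • z) ≤ F x := by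
      by_contra hc
      push Not at hc
      have : 0 < t⁻¹ • (F (x + t • z) - F x) := smul_pos (inv_pos.mpr ht0) (by linarith)
      linarith
    have h4 := hmax _ h3
    simp only [map_add, map_smul, smul_eq_mul] at h4
    by_contra hc
    push Not at hc
    nlinarith [mul_pos ht0 hc]
  have hx : 0 ≤ h x := by simpa using hdesc (-x) (by rw [hneg]; linarith)
  have hone : ∀ y, h y * D x ≤ h x * D y := by
    intro y
    have hη : ∀ η > 0, h y ≤ (D y / D x + η) * h x := by
      intro η hη
      have h1 := hadd y (-(D y / D x + η) • x)
      rw [hsmul] at h1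
      have e : D y + -(D y / D x + η) * D x = -(η * D x) := by field_simp; ring
      have h2 := hdesc (y + -(D y / D x + η) • x) (by
        have := mul_pos hη hpos
        linarith)
      simp only [map_add, map_smul, smul_eq_mul] at h2
      linarith
    have h3 : h y ≤ D y / D x * h x := by
      refine le_of_forall_pos_le_add fun η hη' => ?_
      have h4 := hη (η / (h x + 1)) (by positivity)
      have h5 : η / (h x + 1) * h x ≤ η := by
        rw [div_mul_eq_mul_div, div_le_iff₀ (by positivity)]
        nlinarith
      linarith
    calc h y * D x ≤ D y / D x * h x * D x := by gcongr
      _ = h x * D y := by field_simp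
  refine ⟨hpos, fun y => le_antisymm (hone y) ?_⟩
  have := hone (-y)
  rw [hneg, map_neg] at this
  linarith

/-- The infimal convolution of the norm of `X` with the image of the penalty `q` under `T`. -/
noncomputable def infConv {V X : Type*} [AddCommGroup V] [Module ℝ V] [NormedAddCommGroup X]
    [NormedSpace ℝ X] (T : V →ₗ[ℝ] X) (q : V → ℝ) (x : X) : ℝ :=
  ⨅ v, (‖x - T v‖ + q v)

section infConv

variable {V X : Type*} [AddCommGroup V] [Module ℝ V] [NormedAddCommGroup X] [NormedSpace ℝ X]
  {T : V →ₗ[ℝ] X} {q : V → ℝ}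

theorem infConv_le (hq : ∀ v, 0 ≤ q v) (x : X) (v : V) : infConv T q x ≤ ‖x - T v‖ + q v :=
  ciInf_le ⟨0, by rintro _ ⟨w, rfl⟩; exact add_nonneg (norm_nonneg _) (hq w)⟩ v

theorem exists_lt_of_infConv_lt {x : X} {r : ℝ} (h : infConv T q x < r) :
    ∃ v, ‖x - T v‖ + q v < r :=
  exists_lt_of_ciInf_lt h

theorem infConv_nonneg (hq : ∀ v, 0 ≤ q v) (x : X) : 0 ≤ infConv T q x :=
  le_ciInf fun v => add_nonneg (norm_nonneg _) (hq v)

theorem convexOn_infConv (hq : ∀ v, 0 ≤ q v) (hqc : ConvexOn ℝ univ q) :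
    ConvexOn ℝ univ (infConv T q) := by
  refine ⟨convex_univ, fun x _ y _ a b ha hb hab => ?_⟩
  refine le_of_forall_pos_le_add fun η hη => ?_
  obtain ⟨v, hv⟩ := exists_lt_of_infConv_lt (T := T) (q := q) (lt_add_of_pos_right (infConv T q x) hη)
  obtain ⟨w, hw⟩ := exists_lt_of_infConv_lt (T := T) (q := q) (lt_add_of_pos_right (infConv T q y) hη)
  have h1 := infConv_le (T := T) hq (a • x + b • y) (a • v + b • w)
  have h2 := hqc.2 (mem_univ v) (mem_univ w) ha hb hab
  have h3 : ‖a • x + b • y - T (a • v + b • w)‖ ≤ a * ‖x - T v‖ + b * ‖y - T w‖ := by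
    have e : a • x + b • y - T (a • v + b • w) = a • (x - T v) + b • (y - T w) := by
      simp only [map_add, map_smul]
      module
    rw [e]
    refine (norm_add_le _ _).trans_eq ?_
    rw [norm_smul, norm_smul, Real.norm_of_nonneg ha, Real.norm_of_nonneg hb]
  simp only [smul_eq_mul] at h2 ⊢
  have h4 := mul_le_mul_of_nonneg_left hv.le ha
  have h5 := mul_le_mul_of_nonneg_left hw.le hb
  have h6 : a * η + b * η = η := by rw [← add_mul, hab, one_mul]
  linarith

theorem exists_hasLineDerivAt_infConv (hq : ∀ v, 0 ≤ q v) (hqc : ConvexOn ℝ univ q)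
    (hqs : ∀ w, ∃ C : ℝ, ∀ v, ∀ t : ℝ, q (v + t • w) + q (v - t • w) ≤ 2 * q v + C * t ^ 2)
    (hT : DenseRange T) (x y : X) : ∃ d, HasLineDerivAt ℝ (infConv T q) d x y := by
  refine (convexOn_infConv hq hqc).exists_hasLineDerivAt fun η hη => ?_
  obtain ⟨w, hw⟩ := hT.exists_dist_lt y (half_pos hη)
  rw [dist_eq_norm] at hw
  obtain ⟨C, hC⟩ := hqs w
  refine ⟨C, fun t ht => ?_⟩
  suffices ∀ v, infConv T q (x + t • y) + infConv T q (x - t • y) - (η * t + C * t ^ 2) ≤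
      2 * (‖x - T v‖ + q v) by
    have h1 : (infConv T q (x + t • y) + infConv T q (x - t • y) - (η * t + C * t ^ 2)) / 2 ≤
        infConv T q x := le_ciInf fun v => by linarith [this v]
    linarith
  intro v
  have h1 := infConv_le (T := T) hq (x + t • y) (v + t • w)
  have h2 := infConv_le (T := T) hq (x - t • y) (v - t • w)
  have h3 : ‖x + t • y - T (v + t • w)‖ ≤ ‖x - T v‖ + t * (η / 2) := by
    have e : x + t • y - T (v + t • w) = (x - T v) + t • (y - T w) := by
      simp only [map_add, map_smul]
      module
    rw [e]
    refine (norm_add_le _ _).trans ?_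
    rw [norm_smul, Real.norm_of_nonneg ht.le]
    gcongr
  have h4 : ‖x - t • y - T (v - t • w)‖ ≤ ‖x - T v‖ + t * (η / 2) := by
    have e : x - t • y - T (v - t • w) = (x - T v) - t • (y - T w) := by
      simp only [map_sub, map_smul]
      module
    rw [e]
    refine (norm_sub_le _ _).trans ?_
    rw [norm_smul, Real.norm_of_nonneg ht.le]
    gcongr
  have h5 := hC v t
  linarith

theorem infConv_add_of_invariant (w : V) (hw : ∀ v, q (v + w) = q v) (x : X) :
    infConv T q (x + T w) = infConv T q x := by
  unfold infConv
  rw [← (Equiv.addRight w).iInf_comp]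
  simp [hw]

theorem infConv_neg (hqn : ∀ v, q (-v) = q v) (x : X) : infConv T q (-x) = infConv T q x := by
  unfold infConv
  rw [← (Equiv.neg V).iInf_comp]
  simp only [Equiv.neg_apply, map_neg, hqn, ← neg_sub', norm_neg]

end infConv

theorem exists_hilbert_denseRange (X : Type*) [NormedAddCommGroup X] [NormedSpace ℝ X]
    [CompleteSpace X] [TopologicalSpace.SeparableSpace X] :
    ∃ T : lp (fun _ : ℕ => ℝ) 2 →L[ℝ] X, DenseRange T := by
  let x : ℕ → X := TopologicalSpace.denseSeq X
  let P : ℕ → lp (fun _ : ℕ => ℝ) 2 →L[ℝ] ℝ := fun n =>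
    LinearMap.mkContinuous ⟨⟨fun a => a n, fun a b => rfl⟩, fun c a => rfl⟩ 1 (fun a => by
      rw [one_mul]
      exact lp.norm_apply_le_norm (by norm_num) a n)
  have hPa : ∀ n a, P n a = a n := fun _ _ => rfl
  have hP : ∀ n, ‖P n‖ ≤ 1 := fun n => LinearMap.mkContinuous_norm_le _ zero_le_one _
  let r : ℕ → ℝ := fun n => (1 / 2) ^ n / (1 + ‖x n‖)
  have hr : ∀ n, 0 < r n := fun n => by positivity
  let A : ℕ → lp (fun _ : ℕ => ℝ) 2 →L[ℝ] X := fun n => (P n).smulRight (r n • x n)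
  have hA : Summable A := by
    refine Summable.of_norm_bounded (summable_geometric_of_lt_one (r := 1 / 2)
      (by norm_num) (by norm_num)) fun n => ?_
    rw [ContinuousLinearMap.norm_smulRight_apply, norm_smul, Real.norm_of_nonneg (hr n).le]
    have h1 : r n * ‖x n‖ ≤ (1 / 2) ^ n := by
      simp only [r]
      rw [div_mul_eq_mul_div, div_le_iff₀ (by positivity)]
      have : (0 : ℝ) < (1 / 2) ^ n := by positivity
      nlinarith
    calc ‖P n‖ * (r n * ‖x n‖) ≤ 1 * (1 / 2) ^ n := by
          gcongr
          exact hP n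
      _ = _ := one_mul _
  refine ⟨∑' n, A n, ?_⟩
  refine (TopologicalSpace.denseRange_denseSeq X).mono ?_
  rintro _ ⟨n, rfl⟩
  refine ⟨lp.single 2 n (r n)⁻¹, ?_⟩
  have h1 : (∑' n, A n) (lp.single 2 n (r n)⁻¹) = ∑' m, A m (lp.single 2 n (r n)⁻¹) :=
    ((ContinuousLinearMap.apply ℝ X (lp.single (E := fun _ : ℕ => ℝ) 2 n (r n)⁻¹)).map_tsum hA)
  rw [h1, tsum_eq_single n]
  · simp [A, hPa, smul_smul, (hr n).ne', x]
  · intro m hm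
    simp [A, hPa, lp.single_apply, hm]

/-- The truncation of a real number to `[-1, 1]`. -/
noncomputable def clampOne (t : ℝ) : ℝ := max (-1) (min 1 t)

/-- The squared distance to `[-1, 1]`. -/
noncomputable def sqDistUnit (t : ℝ) : ℝ := (t - clampOne t) ^ 2

/-- The Huber function, an even `C¹` convex primitive of `clampOne`. -/
noncomputable def huber (t : ℝ) : ℝ := (t ^ 2 - sqDistUnit t) / 2

theorem clampOne_cases (t : ℝ) :
    (t ≤ -1 ∧ clampOne t = -1) ∨ (-1 ≤ t ∧ t ≤ 1 ∧ clampOne t = t) ∨ (1 ≤ t ∧ clampOne t = 1) := by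
  unfold clampOne
  rcases le_total t (-1) with h | h
  · left
    exact ⟨h, by rw [min_eq_right (by linarith), max_eq_left h]⟩
  · rcases le_total t 1 with h' | h'
    · right; left
      exact ⟨h, h', by rw [min_eq_right h', max_eq_right h]⟩
    · right; right
      exact ⟨h', by rw [min_eq_left h', max_eq_right (by norm_num)]⟩

theorem clampOne_of_one_le {t : ℝ} (h : 1 ≤ t) : clampOne t = 1 := by
  rw [clampOne, min_eq_left h, max_eq_right (by norm_num)]

theorem clampOne_of_abs_le {t : ℝ} (h : |t| ≤ 1) : clampOne t = t := by
  rw [abs_le] at h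
  rw [clampOne, min_eq_right h.2, max_eq_right h.1]

theorem clampOne_neg (t : ℝ) : clampOne (-t) = -clampOne t := by
  rcases clampOne_cases t with ⟨h, e⟩ | ⟨h, h', e⟩ | ⟨h, e⟩ <;>
  rcases clampOne_cases (-t) with ⟨k, e'⟩ | ⟨k, k', e'⟩ | ⟨k, e'⟩ <;> rw [e, e'] <;> linarith

theorem abs_clampOne_le (t : ℝ) : |clampOne t| ≤ 1 := by
  rw [abs_le]
  rcases clampOne_cases t with ⟨h, e⟩ | ⟨h, h', e⟩ | ⟨h, e⟩ <;> rw [e] <;> constructor <;> linarith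

theorem monotone_clampOne : Monotone clampOne := fun s t h => by
  unfold clampOne
  gcongr

theorem monotone_sub_clampOne : Monotone fun t => t - clampOne t := fun s t h => by
  show s - clampOne s ≤ t - clampOne t
  rcases clampOne_cases s with ⟨h, e⟩ | ⟨h, h', e⟩ | ⟨h, e⟩ <;>
  rcases clampOne_cases t with ⟨k, e'⟩ | ⟨k, k', e'⟩ | ⟨k, e'⟩ <;> rw [e, e'] <;> linarith

theorem sqDistUnit_nonneg (t : ℝ) : 0 ≤ sqDistUnit t := sq_nonneg _

theorem sqDistUnit_of_abs_le {t : ℝ} (h : |t| ≤ 1) : sqDistUnit t = 0 := by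
  simp [sqDistUnit, clampOne_of_abs_le h]

theorem sqDistUnit_neg (t : ℝ) : sqDistUnit (-t) = sqDistUnit t := by
  rw [sqDistUnit, sqDistUnit, clampOne_neg]
  ring

theorem abs_le_two_of_sqDistUnit_le {t : ℝ} (h : sqDistUnit t ≤ 1) : |t| ≤ 2 := by
  have h1 : |t - clampOne t| ≤ 1 := abs_le_one_iff_mul_self_le_one.mpr (by
    rw [sqDistUnit] at h; nlinarith)
  have h2 := abs_clampOne_le t
  have h3 := abs_add_le (t - clampOne t) (clampOne t)
  rw [sub_add_cancel] at h3
  linarith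

theorem hasDerivAt_sqDistUnit (t : ℝ) : HasDerivAt sqDistUnit (2 * (t - clampOne t)) t := by
  have key : ∀ s, |sqDistUnit s - sqDistUnit t - (s - t) * (2 * (t - clampOne t))| ≤ (s - t) ^ 2 := by
    intro s
    rw [sqDistUnit, sqDistUnit, abs_le]
    rcases clampOne_cases s with ⟨h, e⟩ | ⟨h, h', e⟩ | ⟨h, e⟩ <;>
    rcases clampOne_cases t with ⟨k, e'⟩ | ⟨k, k', e'⟩ | ⟨k, e'⟩ <;> rw [e, e'] <;>
    constructor <;> nlinarith
  rw [hasDerivAt_iff_isLittleO]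
  refine Asymptotics.IsBigO.trans_isLittleO (g := fun s => (s - t) ^ 2) ?_ ?_
  · refine Asymptotics.IsBigO.of_bound 1 (Eventually.of_forall fun s => ?_)
    rw [smul_eq_mul, Real.norm_eq_abs, one_mul, Real.norm_of_nonneg (sq_nonneg _)]
    exact key s
  · have := (Asymptotics.isLittleO_pow_id (𝕜 := ℝ) (n := 2) (by norm_num)).comp_tendsto
      (tendsto_sub_nhds_zero_iff.mpr (tendsto_id (x := 𝓝 t)))
    exact this

theorem hasDerivAt_huber (t : ℝ) : HasDerivAt huber (clampOne t) t := by
  have h := ((hasDerivAt_pow 2 t).sub (hasDerivAt_sqDistUnit t)).div_const 2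
  exact h.congr_deriv (by norm_num; ring)

theorem convexOn_sqDistUnit : ConvexOn ℝ univ sqDistUnit := by
  refine Monotone.convexOn_univ_of_deriv (fun t => (hasDerivAt_sqDistUnit t).differentiableAt) ?_
  have : deriv sqDistUnit = fun t => 2 * (t - clampOne t) :=
    funext fun t => (hasDerivAt_sqDistUnit t).deriv
  rw [this]
  intro s t h
  have := monotone_sub_clampOne h
  dsimp only at this ⊢
  linarith

theorem convexOn_huber : ConvexOn ℝ univ huber := by
  refine Monotone.convexOn_univ_of_deriv (fun t => (hasDerivAt_huber t).differentiableAt) ?_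
  rw [show deriv huber = clampOne from funext fun t => (hasDerivAt_huber t).deriv]
  exact monotone_clampOne

theorem huber_neg (t : ℝ) : huber (-t) = huber t := by
  rw [huber, huber, sqDistUnit_neg, neg_sq]

theorem huber_nonneg (t : ℝ) : 0 ≤ huber t := by
  rw [huber, sqDistUnit]
  rcases clampOne_cases t with ⟨h, e⟩ | ⟨h, h', e⟩ | ⟨h, e⟩ <;> rw [e] <;> nlinarith

theorem huber_le_abs (t : ℝ) : huber t ≤ |t| := by
  rw [huber, sqDistUnit]
  rcases clampOne_cases t with ⟨h, e⟩ | ⟨h, h', e⟩ | ⟨h, e⟩ <;> rw [e]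
  · rw [abs_of_nonpos (by linarith)]; nlinarith
  · have : |t| ≤ 1 := abs_le.mpr ⟨h, h'⟩
    nlinarith [abs_nonneg t, sq_abs t]
  · rw [abs_of_nonneg (by linarith)]; nlinarith

/-- Sums of convex functions converge to convex functions. -/
theorem convexOn_tsum {V : Type*} [AddCommGroup V] [Module ℝ V] {F : ℕ → V → ℝ}
    (hF : ∀ n, ConvexOn ℝ univ (F n)) (hs : ∀ x, Summable fun n => F n x) :
    ConvexOn ℝ univ fun x => ∑' n, F n x := by
  refine ⟨convex_univ, fun x _ y _ a b ha hb hab => ?_⟩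
  simp only [smul_eq_mul]
  rw [← tsum_mul_left, ← tsum_mul_left, ← ((hs x).mul_left a).tsum_add ((hs y).mul_left b)]
  exact (hs _).tsum_le_tsum (fun n => (hF n).2 (mem_univ x) (mem_univ y) ha hb hab)
    (((hs x).mul_left a).add ((hs y).mul_left b))

section Dual

variable {X : Type*} [NormedAddCommGroup X] [NormedSpace ℝ X]

theorem summable_sqDistUnit {E : ℕ → X →L[ℝ] ℝ} (hE : ∀ x, Tendsto (fun k => E k x) atTop (𝓝 0))
    (x : X) : Summable fun k => sqDistUnit (E k x) := by
  have h : ∀ᶠ k in atTop, |E k x| ≤ 1 := by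
    filter_upwards [(hE x).abs.eventually_lt_const (show |(0 : ℝ)| < 1 by simp)] with k hk
    exact hk.le
  obtain ⟨N, hN⟩ := eventually_atTop.mp h
  refine summable_of_ne_finset_zero (s := Finset.range N) fun k hk => ?_
  exact sqDistUnit_of_abs_le (hN k (by simpa using hk))

theorem hasLineDerivAt_tsum_sqDistUnit {E : ℕ → X →L[ℝ] ℝ}
    (hE : ∀ x, Tendsto (fun k => E k x) atTop (𝓝 0)) (x y : X) :
    HasLineDerivAt ℝ (fun x => ∑' k, sqDistUnit (E k x))
      (∑' k, 2 * (E k x - clampOne (E k x)) * E k y) x y := by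
  have h : ∀ᶠ k in atTop, |E k x| + |E k y| < 1 :=
    ((hE x).abs.add (hE y).abs).eventually_lt_const (by simp)
  obtain ⟨N, hN⟩ := eventually_atTop.mp h
  have hD : ∑' k, 2 * (E k x - clampOne (E k x)) * E k y =
      ∑ k ∈ Finset.range N, 2 * (E k x - clampOne (E k x)) * E k y := by
    refine tsum_eq_sum fun k hk => ?_
    have := hN k (by simpa using hk)
    rw [clampOne_of_abs_le (by linarith [abs_nonneg (E k y)])]
    simp
  rw [hD]
  have hfin : HasDerivAt (fun t : ℝ => ∑ k ∈ Finset.range N, sqDistUnit (E k (x + t • y)))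
      (∑ k ∈ Finset.range N, 2 * (E k x - clampOne (E k x)) * E k y) 0 := by
    refine HasDerivAt.fun_sum fun k _ => ?_
    have h1 : HasDerivAt (fun t : ℝ => E k (x + t • y)) (E k y) 0 := by
      simpa using ((hasDerivAt_id (0 : ℝ)).mul_const (E k y)).const_add (E k x)
    have h2 := hasDerivAt_sqDistUnit (E k (x + (0 : ℝ) • y))
    have h3 := h2.comp (0 : ℝ) h1
    simpa [Function.comp_def] using h3
  refine hfin.congr_of_eventuallyEq ?_
  filter_upwards [Ioo_mem_nhds (show (-1 : ℝ) < 0 by norm_num) one_pos] with t ht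
  refine tsum_eq_sum fun k hk => sqDistUnit_of_abs_le ?_
  have h1 := hN k (by simpa using hk)
  rw [map_add, map_smul, smul_eq_mul]
  have h2 : |t| ≤ 1 := abs_le.mpr ⟨ht.1.le, ht.2.le⟩
  have h3 := abs_add_le (E k x) (t * E k y)
  rw [abs_mul] at h3
  nlinarith [abs_nonneg (E k y)]

theorem summable_mul_huber {ε : ℕ → ℝ} {v : ℕ → X →L[ℝ] ℝ} (hε : ∀ m, 0 ≤ ε m)
    (hs : Summable fun m => ε m * ‖v m‖) (x : X) : Summable fun m => ε m * huber (v m x) := by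
  refine Summable.of_nonneg_of_le (fun m => mul_nonneg (hε m) (huber_nonneg _)) (fun m => ?_)
    (hs.mul_right ‖x‖)
  rw [mul_assoc]
  gcongr
  · exact hε m
  · exact (huber_le_abs _).trans ((v m).le_opNorm x)

theorem hasLineDerivAt_tsum_mul_huber {ε : ℕ → ℝ} {v : ℕ → X →L[ℝ] ℝ} (hε : ∀ m, 0 ≤ ε m)
    (hs : Summable fun m => ε m * ‖v m‖) (x y : X) :
    HasLineDerivAt ℝ (fun x => ∑' m, ε m * huber (v m x))
      (∑' m, ε m * clampOne (v m x) * v m y) x y := by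
  have h := hasDerivAt_tsum (𝕜 := ℝ) (u := fun m => ε m * ‖v m‖ * ‖y‖)
    (g := fun m t => ε m * huber (v m (x + t • y)))
    (g' := fun m t => ε m * clampOne (v m (x + t • y)) * v m y) (y₀ := 0) (hs.mul_right ‖y‖)
    (fun m t => ?_) (fun m t => ?_) (summable_mul_huber hε hs _) 0
  · unfold HasLineDerivAt
    simpa using h
  · have h1 : HasDerivAt (fun t : ℝ => v m (x + t • y)) (v m y) t := by
      simpa using ((hasDerivAt_id t).mul_const (v m y)).const_add (v m x)
    have h2 := ((hasDerivAt_huber (v m (x + t • y))).comp t h1).const_mul (ε m)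
    simpa [mul_assoc, Function.comp_def] using h2
  · rw [norm_mul, norm_mul, Real.norm_of_nonneg (hε m)]
    calc ε m * ‖clampOne (v m (x + t • y))‖ * ‖v m y‖ ≤ ε m * 1 * (‖v m‖ * ‖y‖) := by
          gcongr
          · simpa using hε m
          · simpa using hε m
          · exact abs_clampOne_le _
          · exact (v m).le_opNorm y
      _ = _ := by ring

end Dual

section Separability

variable {X : Type*} [NormedAddCommGroup X] [NormedSpace ℝ X]

/-- A weakly compactly generated space with a countable separating family of functionals is
separable. -/
theorem separableSpace_of_isCompact_toWeakSpace_image {K : Set X}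
    (hK : IsCompact (toWeakSpace ℝ X '' K)) (hKgen : Dense (Submodule.span ℝ K : Set X))
    {l : ℕ → X →L[ℝ] ℝ} (hl : ∀ x, (∀ n, l n x = 0) → x = 0) :
    TopologicalSpace.SeparableSpace X := by
  set K' : Set (WeakSpace ℝ X) := toWeakSpace ℝ X '' K with hK'
  have : CompactSpace K' := isCompact_iff_compactSpace.mp hK
  have hcont : ∀ n, Continuous fun k : WeakSpace ℝ X => l n ((toWeakSpace ℝ X).symm k) :=
    fun n => WeakBilin.eval_continuous _ (l n)
  have hmet : TopologicalSpace.MetrizableSpace K' :=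
    Metric.PiNatEmbed.TopologicalSpace.MetrizableSpace.of_countable_separating
      (fun n k => l n ((toWeakSpace ℝ X).symm k))
      (fun n => (hcont n).comp continuous_subtype_val)
      fun x y hxy => by
        by_contra! h
        refine hxy (Subtype.ext ((toWeakSpace ℝ X).symm.injective (sub_eq_zero.mp ?_)))
        exact hl _ fun n => by rw [map_sub, h n, sub_self]
  let _ := TopologicalSpace.metrizableSpaceMetric K'
  obtain ⟨D, hDc, hD⟩ := TopologicalSpace.exists_countable_dense K'
  set D' : Set (WeakSpace ℝ X) := Subtype.val '' D
  have hKD : K' ⊆ closure D' := by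
    intro x hx
    exact image_closure_subset_closure_image continuous_subtype_val ⟨⟨x, hx⟩, hD _, rfl⟩
  set W : Submodule ℝ X := Submodule.span ℝ ((toWeakSpace ℝ X).symm '' D')
  have hW : K ⊆ closure (W : Set X) := by
    intro x hx
    have h1 : toWeakSpace ℝ X x ∈ closure (toWeakSpace ℝ X '' (W : Set X)) := by
      refine closure_mono ?_ (hKD (mem_image_of_mem _ hx))
      intro d hd
      exact ⟨(toWeakSpace ℝ X).symm d, Submodule.subset_span (mem_image_of_mem _ hd), by simp⟩
    rw [← W.convex.toWeakSpace_closure ℝ] at h1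
    exact (toWeakSpace ℝ X).injective.mem_set_image.mp h1
  have hWsep : TopologicalSpace.IsSeparable (W : Set X) :=
    (((hDc.image _).image _).isSeparable).span
  have htop : closure (W : Set X) = univ := by
    have h2 : Submodule.span ℝ K ≤ W.topologicalClosure := Submodule.span_le.mpr hW
    refine eq_univ_of_univ_subset ?_
    rw [← hKgen.closure_eq]
    exact closure_minimal h2 isClosed_closure
  rw [← TopologicalSpace.isSeparable_univ_iff, ← htop]
  exact hWsep.closure

theorem exists_apply_eq_one_of_linearIndependent_pair {x y : X}
    (h : LinearIndependent ℝ ![x, y]) : ∃ f : X →L[ℝ] ℝ, f x = 1 ∧ f y = 1 := by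
  let b := Module.Basis.span h
  have : FiniteDimensional ℝ (Submodule.span ℝ (range ![x, y])) := b.finiteDimensional_of_finite
  let g : Submodule.span ℝ (range ![x, y]) →L[ℝ] ℝ :=
    (b.constr ℝ fun _ => (1 : ℝ)).toContinuousLinearMap
  obtain ⟨f, hf, -⟩ := exists_extension_norm_eq _ g
  have hb : ∀ i, f (![x, y] i) = 1 := fun i => by
    have h1 := hf (b i)
    rw [show (b i : X) = ![x, y] i from congrArg Subtype.val (Module.Basis.span_apply h i)] at h1
    rw [h1]
    exact b.constr_basis ℝ _ i
  exact ⟨f, hb 0, hb 1⟩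

/-- In the dual of a separable space there is a sequence of functionals which takes
simultaneously large values at any two linearly independent vectors. -/
theorem exists_seq_forall_linearIndependent_pair [TopologicalSpace.SeparableSpace X] :
    ∃ r : ℕ → X →L[ℝ] ℝ, ∀ x y, LinearIndependent ℝ ![x, y] → ∀ B : ℝ,
      ∃ m, B < r m x ∧ B < r m y := by
  let d : ℕ → X := TopologicalSpace.denseSeq X
  have hd : DenseRange d := TopologicalSpace.denseRange_denseSeq X
  have hu : ∀ p : ℕ × ℕ × ℕ, ∃ u : X →L[ℝ] ℝ,
      (∃ u : X →L[ℝ] ℝ, ‖u‖ ≤ p.2.2 ∧ 1 / 2 < u (d p.1) ∧ 1 / 2 < u (d p.2.1)) →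
      ‖u‖ ≤ p.2.2 ∧ 1 / 2 < u (d p.1) ∧ 1 / 2 < u (d p.2.1) := by
    intro p
    by_cases h : ∃ u : X →L[ℝ] ℝ, ‖u‖ ≤ p.2.2 ∧ 1 / 2 < u (d p.1) ∧ 1 / 2 < u (d p.2.1)
    · exact ⟨h.choose, fun _ => h.choose_spec⟩
    · exact ⟨0, fun h' => (h h').elim⟩
  choose u hu using hu
  let σ := (Denumerable.eqv (ℕ × ℕ × ℕ × ℕ)).symm
  refine ⟨fun m => ((σ m).1 : ℝ) • u (σ m).2, fun x y hxy B => ?_⟩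
  obtain ⟨f, hfx, hfy⟩ := exists_apply_eq_one_of_linearIndependent_pair hxy
  obtain ⟨N, hN⟩ := exists_nat_gt (‖f‖ + 1)
  have hN0 : (0 : ℝ) < N := by linarith [norm_nonneg f]
  have happrox : ∀ z, ∃ i, ∀ v : X →L[ℝ] ℝ, ‖v‖ ≤ N → |v z - v (d i)| ≤ 1 / 4 := by
    intro z
    obtain ⟨i, hi⟩ := hd.exists_dist_lt z (show (0 : ℝ) < 1 / (4 * N) by positivity)
    refine ⟨i, fun v hv => ?_⟩
    rw [← map_sub, ← Real.norm_eq_abs]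
    rw [dist_eq_norm] at hi
    calc ‖v (z - d i)‖ ≤ N * (1 / (4 * N)) := v.le_of_opNorm_le_of_le hv hi.le
      _ = 1 / 4 := by field_simp
  obtain ⟨i, hi⟩ := happrox x
  obtain ⟨j, hj⟩ := happrox y
  have hfN : ‖f‖ ≤ N := by linarith
  obtain ⟨h1, h2, h3⟩ := hu (i, j, N) ⟨f, hfN, by
    have := abs_le.mp (hi f hfN); dsimp only; linarith, by
    have := abs_le.mp (hj f hfN); dsimp only; linarith⟩
  dsimp only at h1 h2 h3
  obtain ⟨l, hl⟩ := exists_nat_gt (4 * |B|)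
  have hlarge : ∀ t : ℝ, 1 / 4 ≤ t → B < l * t := fun t ht => by
    have := le_abs_self B
    nlinarith [abs_nonneg B]
  refine ⟨σ.symm (l, i, j, N), ?_, ?_⟩
  · have := abs_le.mp (hi _ h1)
    simpa using hlarge _ (show 1 / 4 ≤ u (i, j, N) x by linarith)
  · have := abs_le.mp (hj _ h1)
    simpa using hlarge _ (show 1 / 4 ≤ u (i, j, N) y by linarith)

end Separability

section Biorthogonal

variable {X : Type*} [NormedAddCommGroup X] [NormedSpace ℝ X]

/-- Finitely supported sequences, viewed in `c₀`. -/
noncomputable def finsuppToZeroAtInfty : (ℕ →₀ ℝ) →ₗ[ℝ] ZeroAtInftyContinuousMap ℕ ℝ where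
  toFun b := ⟨⟨b, continuous_of_discreteTopology⟩, by
    rw [cocompact_eq_cofinite]
    refine tendsto_const_nhds.congr' ?_
    filter_upwards [b.support.finite_toSet.compl_mem_cofinite] with k hk
    simpa [eq_comm] using hk⟩
  map_add' _ _ := rfl
  map_smul' _ _ := rfl

theorem finsuppToZeroAtInfty_apply (b : ℕ →₀ ℝ) (k : ℕ) : finsuppToZeroAtInfty b k = b k := rfl

theorem ZeroAtInftyContinuousMap.norm_apply_le (u : ZeroAtInftyContinuousMap ℕ ℝ) (k : ℕ) :
    ‖u k‖ ≤ ‖u‖ := by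
  rw [← ZeroAtInftyContinuousMap.norm_toBCF_eq_norm]
  exact u.toBCF.norm_coe_le_norm k

theorem norm_finsuppToZeroAtInfty_le {b : ℕ →₀ ℝ} {B : ℝ} (hB : 0 ≤ B) (hb : ∀ k, |b k| ≤ B) :
    ‖finsuppToZeroAtInfty b‖ ≤ B := by
  rw [← ZeroAtInftyContinuousMap.norm_toBCF_eq_norm]
  exact (BoundedContinuousFunction.norm_le hB).mpr hb

/-- An isomorphic copy of `c₀` contains a sequence equivalent to the unit vector basis, with
bounded biorthogonal functionals. -/
theorem exists_biorthogonal_of_embedding (S : ZeroAtInftyContinuousMap ℕ ℝ →L[ℝ] X) {c : ℝ}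
    (hc : 0 < c) (hS : ∀ u, c * ‖u‖ ≤ ‖S u‖) :
    ∃ (a : ℕ → X) (A : ℕ → X →L[ℝ] ℝ), (∀ i j, A i (a j) = if i = j then 1 else 0) ∧
      (∀ i, ‖A i‖ ≤ 1 / c) ∧ ∀ (b : ℕ →₀ ℝ) (B : ℝ), 0 ≤ B → (∀ k, |b k| ≤ B) →
        ‖Finsupp.linearCombination ℝ a b‖ ≤ ‖S‖ * B := by
  have hinj : Function.Injective S := by
    rw [injective_iff_map_eq_zero]
    intro u hu
    have := hS u
    rw [hu, norm_zero] at this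
    exact norm_le_zero_iff.mp (nonpos_of_mul_nonpos_right this hc)
  let R := LinearEquiv.ofInjective (S : ZeroAtInftyContinuousMap ℕ ℝ →ₗ[ℝ] X) hinj
  have hR : ∀ y, S (R.symm y) = y := fun y =>
    congrArg Subtype.val (R.apply_symm_apply y)
  have hRS : ∀ u, R.symm ⟨S u, LinearMap.mem_range_self _ u⟩ = u := fun u =>
    R.symm_apply_apply u
  have hA : ∀ i, ∃ f : X →L[ℝ] ℝ, (∀ u, f (S u) = u i) ∧ ‖f‖ ≤ 1 / c := by
    intro i
    let g : LinearMap.range (S : ZeroAtInftyContinuousMap ℕ ℝ →ₗ[ℝ] X) →L[ℝ] ℝ :=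
      LinearMap.mkContinuous ⟨⟨fun y => R.symm y i, fun y z => by simp⟩, fun t y => by simp⟩ (1 / c)
        fun y => by
          rw [one_div, inv_mul_eq_div, le_div_iff₀ hc, mul_comm]
          have h1 := hS (R.symm y)
          rw [hR] at h1
          have h2 := (R.symm y).norm_apply_le i
          exact (mul_le_mul_of_nonneg_left h2 hc.le).trans h1
    obtain ⟨f, hf, hn⟩ := exists_extension_norm_eq _ g
    refine ⟨f, fun u => ?_, ?_⟩
    · have h1 := hf ⟨S u, LinearMap.mem_range_self _ u⟩
      rw [show f (S u) = _ from h1]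
      show R.symm _ i = u i
      rw [hRS]
    · rw [hn]
      exact LinearMap.mkContinuous_norm_le _ (by positivity) _
  choose A hA hAn using hA
  let T := (S : ZeroAtInftyContinuousMap ℕ ℝ →ₗ[ℝ] X) ∘ₗ finsuppToZeroAtInfty
  refine ⟨fun j => T (Finsupp.single j 1), A, fun i j => ?_, hAn, fun b B hB hb => ?_⟩
  · show A i (S _) = _
    rw [hA, finsuppToZeroAtInfty_apply, Finsupp.single_apply]
    simp [eq_comm]
  · have h1 : Finsupp.linearCombination ℝ (fun j => T (Finsupp.single j 1)) = T := by
      ext j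
      simp
    rw [h1]
    exact S.le_of_opNorm_le_of_le le_rfl (norm_finsuppToZeroAtInfty_le hB hb)

/-- A sequence dominated by the unit vector basis of `c₀` is weakly null. -/
theorem tendsto_apply_zero_of_norm_linearCombination_le {a : ℕ → X} {M : ℝ}
    (ha : ∀ (b : ℕ →₀ ℝ) (B : ℝ), 0 ≤ B → (∀ k, |b k| ≤ B) →
      ‖Finsupp.linearCombination ℝ a b‖ ≤ M * B) (f : X →L[ℝ] ℝ) :
    Tendsto (fun k => f (a k)) atTop (𝓝 0) := by
  rw [tendsto_zero_iff_abs_tendsto_zero]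
  refine Summable.tendsto_atTop_zero (summable_of_sum_le (c := ‖f‖ * M)
    (fun k => abs_nonneg _) fun s => ?_)
  let b : ℕ →₀ ℝ := Finsupp.indicator s fun k _ => SignType.sign (f (a k))
  have hb : ∀ k, |b k| ≤ 1 := by
    intro k
    simp only [b, Finsupp.indicator_apply]
    split_ifs
    · rcases lt_trichotomy (f (a k)) 0 with h | h | h <;> simp [h]
    · simp
  have h1 := ha b 1 zero_le_one hb
  have h2 : f (Finsupp.linearCombination ℝ a b) = ∑ k ∈ s, |f (a k)| := by
    rw [Finsupp.linearCombination_apply, Finsupp.sum_of_support_subset b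
      (Finsupp.support_indicator_subset s _) _ (by simp), map_sum]
    refine Finset.sum_congr rfl fun k hk => ?_
    simp [b, Finsupp.indicator_apply, hk]
  simp only [Function.comp_apply]
  rw [← h2]
  refine (le_abs_self _).trans (f.le_of_opNorm_le_of_le le_rfl (by simpa using h1))

/-- Passing to a subsequence of a sequence equivalent to the unit vector basis of `c₀` in a
separable space, one can arrange that the biorthogonal functionals are weak-star null and that a
weakly null sequence of seminorms is rapidly decreasing along it. -/
theorem exists_biorthogonal_tendsto_zero [TopologicalSpace.SeparableSpace X]
    {a : ℕ → X} {A : ℕ → X →L[ℝ] ℝ} {C M : ℝ}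
    (hAa : ∀ i j, A i (a j) = if i = j then 1 else 0) (hA : ∀ i, ‖A i‖ ≤ C)
    (ha : ∀ (b : ℕ →₀ ℝ) (B : ℝ), 0 ≤ B → (∀ k, |b k| ≤ B) →
      ‖Finsupp.linearCombination ℝ a b‖ ≤ M * B)
    {ε : ℕ → ℝ} {r : ℕ → X →L[ℝ] ℝ} (hε : ∀ m, 0 ≤ ε m) (hs : Summable fun m => ε m * ‖r m‖) :
    ∃ (e : ℕ → X) (E : ℕ → X →L[ℝ] ℝ) (C' : ℝ), (∀ i j, E i (e j) = if i = j then 1 else 0) ∧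
      (∀ i, ‖E i‖ ≤ C') ∧ (∀ x, Tendsto (fun k => E k x) atTop (𝓝 0)) ∧
      (∀ (b : ℕ →₀ ℝ) (B : ℝ), 0 ≤ B → (∀ k, |b k| ≤ B) →
        ‖Finsupp.linearCombination ℝ e b‖ ≤ M * B) ∧
      ∀ k, ∑' m, ε m * |r m (e k)| ≤ (1 / 4) ^ k := by
  obtain ⟨F, -, φ, hφ, hF⟩ := WeakDual.isSeqCompact_closedBall ℝ X 0 C
    (x := fun k => StrongDual.toWeakDual (A k)) fun k => by
      simpa using hA k
  have hF' : ∀ x, Tendsto (fun k => A (φ k) x) atTop (𝓝 (F x)) := fun x =>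
    ((WeakDual.eval_continuous x).tendsto F).comp hF
  have hFa : ∀ j, F (a j) = 0 := by
    intro j
    refine tendsto_nhds_unique (hF' (a j)) (tendsto_const_nhds.congr' ?_)
    filter_upwards [eventually_gt_atTop j] with k hk
    rw [hAa, if_neg (hk.trans_le (hφ.le_apply)).ne']
  have hbound : ∀ k, ‖a k‖ ≤ M := fun k => by
    have := ha (Finsupp.single k 1) 1 zero_le_one fun i => by
      rw [Finsupp.single_apply]; split_ifs <;> simp
    simpa using this
  have hβ : Tendsto (fun k => ∑' m, ε m * |r m (a k)|) atTop (𝓝 0) := by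
    have h1 := tendsto_tsum_of_dominated_convergence (𝓕 := atTop)
      (f := fun k m => ε m * |r m (a k)|) (g := fun _ => (0 : ℝ))
      (bound := fun m => ε m * ‖r m‖ * M) (hs.mul_right M)
      (fun m => by
        simpa using (tendsto_apply_zero_of_norm_linearCombination_le ha (r m)).abs.const_mul (ε m))
      (Eventually.of_forall fun k m => by
        rw [Real.norm_of_nonneg (mul_nonneg (hε m) (abs_nonneg _)), mul_assoc]
        gcongr
        · exact hε m
        · exact (r m).le_of_opNorm_le_of_le le_rfl (hbound k))
    simpa using h1
  obtain ⟨ψ, hψ, hψβ⟩ := extraction_forall_of_eventually'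
    (P := fun n k => ∑' m, ε m * |r m (a (φ k))| ≤ (1 / 4) ^ n) fun n =>
      eventually_atTop.mp ((hβ.comp hφ.tendsto_atTop).eventually_le_const
        (show (0 : ℝ) < (1 / 4) ^ n by positivity))
  have hinj : Function.Injective fun k => φ (ψ k) := (hφ.comp hψ).injective
  refine ⟨fun k => a (φ (ψ k)), fun k => A (φ (ψ k)) - WeakDual.toStrongDual F,
    C + ‖WeakDual.toStrongDual F‖, fun i j => ?_, fun i => ?_, fun x => ?_, fun b B hB hb => ?_,
    hψβ⟩
  · have h1 := hFa (φ (ψ j))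
    rw [sub_apply, WeakDual.toStrongDual_apply, h1, hAa, sub_zero]
    simp only [hinj.eq_iff]
  · exact (norm_sub_le _ _).trans (by gcongr; exact hA _)
  · have := ((hF' x).comp hψ.tendsto_atTop).sub_const (F x)
    simpa using this
  · have h1 := Finsupp.linearCombination_mapDomain ℝ (v' := a) (fun k => φ (ψ k)) b
    rw [show Finsupp.linearCombination ℝ (fun k => a (φ (ψ k))) b = _ from h1.symm]
    refine ha _ B hB fun k => ?_
    by_cases hk : k ∈ range fun k => φ (ψ k)
    · obtain ⟨i, rfl⟩ := hk
      rw [Finsupp.mapDomain_apply hinj]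
      exact hb i
    · rw [Finsupp.mapDomain_of_notMem_range _ _ hk]
      simpa using hB

end Biorthogonal

section Construction

variable {X : Type*} [NormedAddCommGroup X] [NormedSpace ℝ X]

theorem exists_functionals_apply_eq_ite {e : ℕ → X} {E : ℕ → X →L[ℝ] ℝ} {C : ℝ}
    (hEe : ∀ i j, E i (e j) = if i = j then 1 else 0) (hE : ∀ i, ‖E i‖ ≤ C) :
    ∃ w : ℕ → X →L[ℝ] ℝ, (∀ m, ‖w m‖ ≤ 2 * C) ∧
      ∀ m k, w m (e k) = if (Nat.unpair k).1 = m then (1 / 2) ^ k else 0 := by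
  let s : ℕ → ℕ → ℝ := fun m k => if (Nat.unpair k).1 = m then (1 / 2) ^ k else 0
  have hs : ∀ m k, ‖s m k • E k‖ ≤ (1 / 2) ^ k * C := fun m k => by
    have h1 : ‖s m k‖ ≤ (1 / 2) ^ k := by
      simp only [s]
      split_ifs
      · rw [Real.norm_of_nonneg (by positivity)]
      · rw [norm_zero]; positivity
    rw [norm_smul]
    gcongr
    exact hE k
  have hgeom : HasSum (fun k : ℕ => (1 / 2 : ℝ) ^ k * C) (2 * C) :=
    hasSum_geometric_two.mul_right C
  refine ⟨fun m => ∑' k, s m k • E k, fun m => tsum_of_norm_bounded hgeom (hs m), fun m k => ?_⟩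
  have hsum : Summable fun k => s m k • E k := Summable.of_norm_bounded hgeom.summable (hs m)
  have h1 : (∑' k, s m k • E k) (e k) = ∑' i, (s m i • E i) (e k) :=
    (ContinuousLinearMap.apply ℝ ℝ (e k)).map_tsum hsum
  rw [h1, tsum_eq_single k]
  · show s m k • E k (e k) = s m k
    rw [hEe, if_pos rfl, smul_eq_mul, mul_one]
  · intro i hi
    show s m i • E i (e k) = 0
    rw [hEe, if_neg hi, smul_zero]

/-- The squared norm of the Hilbert space component. -/
noncomputable def hilbertPenalty (H : Type*) [NormedAddCommGroup H] (p : H × (ℕ →₀ ℝ)) : ℝ :=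
  ‖p.1‖ ^ 2

theorem hilbertPenalty_nonneg {H : Type*} [NormedAddCommGroup H] (p : H × (ℕ →₀ ℝ)) :
    0 ≤ hilbertPenalty H p :=
  sq_nonneg _

variable {H : Type*} [NormedAddCommGroup H] [InnerProductSpace ℝ H]

theorem convexOn_hilbertPenalty : ConvexOn ℝ univ (hilbertPenalty H) :=
  ((convexOn_univ_norm (E := H)).pow (fun _ _ => norm_nonneg _) 2).comp_linearMap
    (LinearMap.fst ℝ H (ℕ →₀ ℝ))

theorem hilbertPenalty_add_sub (w v : H × (ℕ →₀ ℝ)) (t : ℝ) :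
    hilbertPenalty H (v + t • w) + hilbertPenalty H (v - t • w) =
      2 * hilbertPenalty H v + 2 * ‖w.1‖ ^ 2 * t ^ 2 := by
  have h := parallelogram_law_with_norm ℝ v.1 (t • w.1)
  rw [norm_smul, Real.norm_eq_abs] at h
  simp only [hilbertPenalty, Prod.fst_add, Prod.fst_sub, Prod.smul_fst]
  nlinarith [sq_abs t]

/-- The data from which the renorming is built. -/
structure RenormingData (H X : Type*) [NormedAddCommGroup H] [InnerProductSpace ℝ H]
    [NormedAddCommGroup X] [NormedSpace ℝ X] where
  /-- An operator with dense range. -/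
  T : H →L[ℝ] X
  /-- A sequence dominated by the unit vector basis of `c₀`. -/
  e : ℕ → X
  /-- Functionals biorthogonal to `e`. -/
  E : ℕ → X →L[ℝ] ℝ
  /-- Functionals small on `e`. -/
  r : ℕ → X →L[ℝ] ℝ
  /-- Functionals having prescribed values on `e`. -/
  w : ℕ → X →L[ℝ] ℝ
  /-- Weights. -/
  ε : ℕ → ℝ
  /-- Bound on `E`. -/
  C : ℝ
  /-- Domination constant of `e`. -/
  M : ℝ
  denseRange_T : DenseRange T
  E_e : ∀ i j, E i (e j) = if i = j then 1 else 0
  norm_E_le : ∀ i, ‖E i‖ ≤ C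
  tendsto_E : ∀ x, Tendsto (fun k => E k x) atTop (𝓝 0)
  norm_linearCombination_le : ∀ (b : ℕ →₀ ℝ) (B : ℝ), 0 ≤ B → (∀ k, |b k| ≤ B) →
    ‖Finsupp.linearCombination ℝ e b‖ ≤ M * B
  ε_pos : ∀ m, 0 < ε m
  summable_ε_r : Summable fun m => ε m * ‖r m‖
  summable_ε_w : Summable fun m => ε m * ‖w m‖
  tsum_r_e_le : ∀ k, ∑' m, ε m * |r m (e k)| ≤ (1 / 4) ^ k
  w_e : ∀ m k, w m (e k) = if (Nat.unpair k).1 = m then (1 / 2) ^ k else 0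

namespace RenormingData

variable (d : RenormingData H X)

/-- The functionals to which the Huber function is applied. -/
noncomputable def v (m : ℕ) : X →L[ℝ] ℝ := d.r m + d.w m

/-- The operator underlying the infimal convolution. -/
noncomputable def L : H × (ℕ →₀ ℝ) →ₗ[ℝ] X :=
  (d.T : H →ₗ[ℝ] X).coprod (Finsupp.linearCombination ℝ d.e)

theorem L_apply (p : H × (ℕ →₀ ℝ)) :
    d.L p = d.T p.1 + Finsupp.linearCombination ℝ d.e p.2 := rfl

theorem denseRange_L : DenseRange d.L := by
  refine d.denseRange_T.mono ?_
  rintro _ ⟨a, rfl⟩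
  exact ⟨(a, 0), by simp [L_apply]⟩

/-- The convex function whose unit sublevel set is the unit ball of the new norm. -/
noncomputable def Φ (x : X) : ℝ :=
  infConv d.L (hilbertPenalty H) x + ∑' k, sqDistUnit (d.E k x) + ∑' m, d.ε m * huber (d.v m x)

theorem C_nonneg : 0 ≤ d.C := (norm_nonneg _).trans (d.norm_E_le 0)

theorem summable_ε_v : Summable fun m => d.ε m * ‖d.v m‖ := by
  refine Summable.of_nonneg_of_le (fun m => mul_nonneg (d.ε_pos m).le (norm_nonneg _)) (fun m => ?_)
    (d.summable_ε_r.add d.summable_ε_w)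
  rw [← mul_add]
  exact mul_le_mul_of_nonneg_left (norm_add_le _ _) (d.ε_pos m).le

theorem summable_huber (x : X) : Summable fun m => d.ε m * huber (d.v m x) :=
  summable_mul_huber (fun m => (d.ε_pos m).le) d.summable_ε_v x

theorem convexOn_Φ : ConvexOn ℝ univ d.Φ := by
  have h1 : ConvexOn ℝ univ fun x => ∑' k, sqDistUnit (d.E k x) :=
    convexOn_tsum (F := fun k x => sqDistUnit (d.E k x))
      (fun k => convexOn_sqDistUnit.comp_linearMap (d.E k : X →ₗ[ℝ] ℝ))
      (summable_sqDistUnit d.tendsto_E)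
  have h2 : ConvexOn ℝ univ fun x => ∑' m, d.ε m * huber (d.v m x) :=
    convexOn_tsum (F := fun m x => d.ε m * huber (d.v m x))
      (fun m => (convexOn_huber.comp_linearMap (d.v m : X →ₗ[ℝ] ℝ)).smul (d.ε_pos m).le)
      d.summable_huber
  have h3 : ConvexOn ℝ univ (infConv d.L (hilbertPenalty H)) :=
    convexOn_infConv hilbertPenalty_nonneg convexOn_hilbertPenalty
  exact (h3.add h1).add h2

theorem Φ_neg (x : X) : d.Φ (-x) = d.Φ x := by
  unfold Φ
  rw [infConv_neg fun v => by simp [hilbertPenalty]]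
  simp [sqDistUnit_neg, huber_neg]

theorem infConv_le_Φ (x : X) : infConv d.L (hilbertPenalty H) x ≤ d.Φ x := by
  have h1 : 0 ≤ ∑' k, sqDistUnit (d.E k x) := tsum_nonneg fun k => sqDistUnit_nonneg _
  have h2 : 0 ≤ ∑' m, d.ε m * huber (d.v m x) :=
    tsum_nonneg fun m => mul_nonneg (d.ε_pos m).le (huber_nonneg _)
  unfold Φ
  linarith

theorem sqDistUnit_le_Φ (x : X) (k : ℕ) : sqDistUnit (d.E k x) ≤ d.Φ x := by
  have h0 := infConv_nonneg (T := d.L) hilbertPenalty_nonneg x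
  have h1 : sqDistUnit (d.E k x) ≤ ∑' k, sqDistUnit (d.E k x) :=
    (summable_sqDistUnit d.tendsto_E x).le_tsum k fun _ _ => sqDistUnit_nonneg _
  have h2 : 0 ≤ ∑' m, d.ε m * huber (d.v m x) :=
    tsum_nonneg fun m => mul_nonneg (d.ε_pos m).le (huber_nonneg _)
  unfold Φ
  linarith

theorem exists_norm_le_of_Φ_le_one : ∃ R, ∀ x, d.Φ x ≤ 1 → ‖x‖ ≤ R := by
  set C₁ := 2 + ‖d.T‖ ^ 2 with hC₁
  have hC₁0 : 0 ≤ C₁ := by positivity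
  have hC := d.C_nonneg
  refine ⟨C₁ + d.M * (2 + d.C * C₁), fun x hx => ?_⟩
  obtain ⟨⟨a, b⟩, hab⟩ := exists_lt_of_infConv_lt
    (((d.infConv_le_Φ x).trans hx).trans_lt one_lt_two)
  rw [L_apply, hilbertPenalty] at hab
  dsimp only at hab
  set y := Finsupp.linearCombination ℝ d.e b with hy
  have h1 : ‖d.T a‖ ≤ ‖d.T‖ ^ 2 + ‖a‖ ^ 2 := by
    have := d.T.le_opNorm a
    nlinarith [sq_nonneg (‖d.T‖ - ‖a‖), sq_nonneg ‖d.T‖, sq_nonneg ‖a‖]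
  have h2 : ‖x - y‖ ≤ C₁ := by
    have : x - y = (x - (d.T a + y)) + d.T a := by abel
    rw [this]
    have := norm_add_le (x - (d.T a + y)) (d.T a)
    linarith
  have h3 : ∀ k, |b k| ≤ 2 + d.C * C₁ := by
    intro k
    have e1 : d.E k y = b k := by
      rw [hy, Finsupp.linearCombination_apply, map_finsuppSum]
      simp only [map_smul, d.E_e, smul_eq_mul, mul_ite, mul_one, mul_zero]
      exact Finsupp.sum_ite_self_eq b k
    have e2 : |d.E k x| ≤ 2 := abs_le_two_of_sqDistUnit_le ((d.sqDistUnit_le_Φ x k).trans hx)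
    have e3 : |d.E k (x - y)| ≤ d.C * C₁ := (d.E k).le_of_opNorm_le_of_le (d.norm_E_le k) h2
    rw [map_sub, e1] at e3
    rw [abs_le] at *
    constructor <;> linarith
  have h4 := d.norm_linearCombination_le b _ (by positivity) h3
  have h5 := norm_add_le (x - y) y
  rw [sub_add_cancel] at h5
  linarith

theorem exists_Φ_le_one_of_norm_le : ∃ ρ > 0, ∀ x, ‖x‖ ≤ ρ → d.Φ x ≤ 1 := by
  set Q := ∑' m, d.ε m * ‖d.v m‖ with hQ
  have hC := d.C_nonneg
  have hQ0 : 0 ≤ Q := tsum_nonneg fun m => mul_nonneg (d.ε_pos m).le (norm_nonneg _)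
  refine ⟨1 / (1 + d.C + Q), by positivity, fun x hx => ?_⟩
  rw [le_div_iff₀ (by positivity)] at hx
  have hx0 := norm_nonneg x
  have h1 : infConv d.L (hilbertPenalty H) x ≤ ‖x‖ := by
    simpa [hilbertPenalty] using infConv_le (T := d.L) hilbertPenalty_nonneg x 0
  have h2 : ∑' k, sqDistUnit (d.E k x) = 0 := by
    have : ∀ k, sqDistUnit (d.E k x) = 0 := fun k => by
      refine sqDistUnit_of_abs_le (((d.E k).le_of_opNorm_le (d.norm_E_le k) x).trans ?_)
      nlinarith
    simp [this]
  have h3 : ∑' m, d.ε m * huber (d.v m x) ≤ Q * ‖x‖ := by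
    rw [hQ, ← tsum_mul_right]
    refine (d.summable_huber x).tsum_le_tsum (fun m => ?_) (d.summable_ε_v.mul_right _)
    rw [mul_assoc]
    exact mul_le_mul_of_nonneg_left ((huber_le_abs _).trans ((d.v m).le_opNorm x)) (d.ε_pos m).le
  unfold Φ
  rw [h2]
  nlinarith

theorem Φ_zero : d.Φ 0 = 0 := by
  have h1 : infConv d.L (hilbertPenalty H) 0 = 0 :=
    le_antisymm (by simpa [hilbertPenalty] using infConv_le (T := d.L) hilbertPenalty_nonneg 0 0)
      (infConv_nonneg hilbertPenalty_nonneg 0)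
  simp [Φ, h1, sqDistUnit_of_abs_le, huber]

theorem infConv_add_smul_e (x : X) (k : ℕ) (t : ℝ) :
    infConv d.L (hilbertPenalty H) (x + t • d.e k) = infConv d.L (hilbertPenalty H) x := by
  have h := infConv_add_of_invariant (T := d.L) (q := hilbertPenalty H) (0, Finsupp.single k t)
    (fun v => by simp [hilbertPenalty]) x
  simpa [L_apply] using h

theorem abs_tsum_sub_le (x : X) (k : ℕ) :
    |∑' m, d.ε m * clampOne (d.v m x) * d.v m (d.e k) -
      d.ε (Nat.unpair k).1 * clampOne (d.v (Nat.unpair k).1 x) * (1 / 2) ^ k| ≤ (1 / 4) ^ k := by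
  have hs : Summable fun m => d.ε m * |d.r m (d.e k)| := by
    refine Summable.of_nonneg_of_le (fun m => mul_nonneg (d.ε_pos m).le (abs_nonneg _)) (fun m => ?_)
      (d.summable_ε_r.mul_right ‖d.e k‖)
    rw [mul_assoc]
    exact mul_le_mul_of_nonneg_left ((d.r m).le_opNorm _) (d.ε_pos m).le
  have hle : ∀ m, ‖d.ε m * clampOne (d.v m x) * d.r m (d.e k)‖ ≤ d.ε m * |d.r m (d.e k)| := by
    intro m
    rw [norm_mul, norm_mul, Real.norm_of_nonneg (d.ε_pos m).le]
    exact mul_le_mul_of_nonneg_right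
      (mul_le_of_le_one_right (d.ε_pos m).le (abs_clampOne_le _)) (norm_nonneg _)
  have h1 : Summable fun m => d.ε m * clampOne (d.v m x) * d.r m (d.e k) :=
    Summable.of_norm_bounded hs hle
  have h2 : HasSum (fun m => d.ε m * clampOne (d.v m x) * d.w m (d.e k))
      (d.ε (Nat.unpair k).1 * clampOne (d.v (Nat.unpair k).1 x) * (1 / 2) ^ k) := by
    convert hasSum_single (Nat.unpair k).1 fun m hm => ?_ using 1
    · rw [d.w_e, if_pos rfl]
    · rw [d.w_e, if_neg hm.symm, mul_zero]
  have h3 : ∑' m, d.ε m * clampOne (d.v m x) * d.v m (d.e k) =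
      ∑' m, d.ε m * clampOne (d.v m x) * d.r m (d.e k) +
      d.ε (Nat.unpair k).1 * clampOne (d.v (Nat.unpair k).1 x) * (1 / 2) ^ k := by
    rw [← h2.tsum_eq, ← h1.tsum_add h2.summable]
    refine tsum_congr fun m => ?_
    rw [← mul_add]
    rfl
  rw [h3, add_sub_cancel_right]
  exact (tsum_of_norm_bounded hs.hasSum hle).trans (d.tsum_r_e_le k)

/-- `Φ` has directional derivatives, which on `e` are asymptotically determined by the truncations
of the functionals `v`. -/
theorem exists_hasLineDerivAt_Φ (x : X) : ∃ D : X → ℝ, (∀ y, HasLineDerivAt ℝ d.Φ (D y) x y) ∧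
    ∀ᶠ k in atTop, |D (d.e k) -
      d.ε (Nat.unpair k).1 * clampOne (d.v (Nat.unpair k).1 x) * (1 / 2) ^ k| ≤ (1 / 4) ^ k := by
  have hinf := fun y => exists_hasLineDerivAt_infConv (T := d.L) hilbertPenalty_nonneg
    convexOn_hilbertPenalty (fun w => ⟨_, fun v t => (hilbertPenalty_add_sub w v t).le⟩)
    d.denseRange_L x y
  choose δ hδ using hinf
  refine ⟨fun y => δ y + ∑' k, 2 * (d.E k x - clampOne (d.E k x)) * d.E k y +
    ∑' m, d.ε m * clampOne (d.v m x) * d.v m y, fun y => ?_, ?_⟩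
  · exact ((hδ y).add (hasLineDerivAt_tsum_sqDistUnit d.tendsto_E x y)).add
      (hasLineDerivAt_tsum_mul_huber (fun m => (d.ε_pos m).le) d.summable_ε_v x y)
  · filter_upwards [(d.tendsto_E x).abs.eventually_lt_const (show |(0 : ℝ)| < 1 by simp)] with k hk
    have h1 : δ (d.e k) = 0 := by
      refine (hδ (d.e k)).unique ?_
      unfold HasLineDerivAt
      simp only [d.infConv_add_smul_e]
      exact hasDerivAt_const _ _
    have h2 : ∑' i, 2 * (d.E i x - clampOne (d.E i x)) * d.E i (d.e k) = 0 := by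
      rw [tsum_eq_single k fun i hi => by rw [d.E_e, if_neg hi, mul_zero],
        clampOne_of_abs_le hk.le]
      simp
    rw [h1, h2, add_zero, zero_add]
    exact d.abs_tsum_sub_le x k

end RenormingData

end Construction

section Renorming

variable {X : Type*} [NormedAddCommGroup X] [NormedSpace ℝ X]

/-- The gauge of the unit sublevel set of an even convex function. -/
theorem exists_seminorm_of_convexOn {F : X → ℝ} (hF : ConvexOn ℝ univ F)
    (hneg : ∀ x, F (-x) = F x) (hball : ∃ ρ > 0, ∀ x, ‖x‖ ≤ ρ → F x ≤ 1)
    (hbdd : ∃ R, ∀ x, F x ≤ 1 → ‖x‖ ≤ R)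
    (hcont : ∀ x, ContinuousAt (fun t : ℝ => F (x + t • x)) 0) :
    ∃ p : Seminorm ℝ X, (∃ c > 0, ∃ C, ∀ x, c * ‖x‖ ≤ p x ∧ p x ≤ C * ‖x‖) ∧
      (∀ x, F x ≤ 1 → p x ≤ 1) ∧ ∀ x, p x = 1 → F x = 1 := by
  obtain ⟨ρ, hρ, hball⟩ := hball
  obtain ⟨R, hR⟩ := hbdd
  let s : Set X := {x | F x ≤ 1}
  have hs : Convex ℝ s := by simpa [s] using hF.convex_le 1
  have hbs : Metric.ball 0 ρ ⊆ s := fun x hx => hball x (mem_ball_zero_iff.mp hx).le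
  have hsn : s ∈ 𝓝 0 := mem_of_superset (Metric.ball_mem_nhds 0 hρ) hbs
  have ha : Absorbent ℝ s := absorbent_nhds_zero hsn
  have h0 : (0 : X) ∈ s := mem_of_mem_nhds hsn
  have hb : Balanced ℝ s := (balanced_iff_neg_mem hs).mpr fun x hx => (hneg x).trans_le hx
  let p := gaugeSeminorm hb hs ha
  have hR1 : s ⊆ Metric.closedBall 0 (|R| + 1) := fun x hx =>
    mem_closedBall_zero_iff.mpr ((hR x hx).trans ((le_abs_self R).trans (by linarith)))
  have hle : ∀ x, F x ≤ 1 → p x ≤ 1 := fun x hx => gauge_le_one_of_mem hx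
  refine ⟨p, ⟨(|R| + 1)⁻¹, by positivity, ρ⁻¹, fun x => ⟨?_, ?_⟩⟩, hle, fun x hx => ?_⟩
  · rw [inv_mul_eq_div]
    exact le_gauge_of_subset_closedBall ha (by positivity) hR1
  · rw [inv_mul_eq_div, le_div_iff₀' hρ]
    exact mul_gauge_le_norm hbs
  · have hsm : ∀ t : ℝ, -1 < t → p (x + t • x) = 1 + t := fun t ht => by
      have e : x + t • x = (1 + t) • x := by module
      rw [e, map_smul_eq_mul, hx, Real.norm_of_nonneg (by linarith), mul_one]
    have hx0 : F x = F (x + (0 : ℝ) • x) := by simp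
    rw [hx0]
    refine le_antisymm ?_ ?_
    · refine le_of_tendsto ((hcont x).mono_left (nhdsWithin_le_nhds (s := Iio 0))) ?_
      filter_upwards [Ioo_mem_nhdsLT (show (-1 : ℝ) < 0 by norm_num)] with t ht
      refine setOfPred_gauge_lt_one_subset_self hs h0 ha ?_
      have : p (x + t • x) < 1 := by rw [hsm t ht.1]; linarith [ht.2]
      exact this
    · refine ge_of_tendsto ((hcont x).mono_left (nhdsWithin_le_nhds (s := Ioi 0))) ?_
      filter_upwards [self_mem_nhdsWithin] with t (ht : 0 < t)
      by_contra! h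
      have := hle _ h.le
      rw [hsm t (by linarith)] at this
      linarith

/-- An equivalent norm on `X` is realized, up to isomorphism, on any linearly isomorphic carrier. -/
theorem exists_continuousLinearEquiv_norm_eq.{v} {Y : Type v} [CompleteSpace X]
    [AddCommGroup Y] [Module ℝ Y] (L : X ≃ₗ[ℝ] Y) (p : Seminorm ℝ X) {c C : ℝ} (hc : 0 < c) (hp : ∀ x, c * ‖x‖ ≤ p x ∧ p x ≤ C * ‖x‖) :
    ∃ (X' : Type v) (_ : NormedAddCommGroup X') (_ : NormedSpace ℝ X') (_ : CompleteSpace X')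
      (e : X ≃L[ℝ] X'), ∀ x, ‖e x‖ = p x := by
  let _ : Norm Y := ⟨fun y => p (L.symm y)⟩
  have core : NormedSpace.Core ℝ Y :=
    { norm_nonneg := fun y => apply_nonneg p _
      norm_smul := fun t y => by
        show p _ = _ * p _
        rw [map_smul, map_smul_eq_mul]
      norm_triangle := fun y z => by
        show p _ ≤ p _ + p _
        rw [map_add]
        exact map_add_le_add p _ _
      norm_eq_zero_iff := fun y => by
        show p _ = 0 ↔ _
        refine ⟨fun h => ?_, fun h => by rw [h, map_zero, map_zero]⟩
        have h1 := (hp (L.symm y)).1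
        rw [h] at h1
        have h2 := norm_le_zero_iff.mp (nonpos_of_mul_nonpos_right h1 hc)
        exact L.symm.map_eq_zero_iff.mp h2 }
  let i1 : NormedAddCommGroup Y := NormedAddCommGroup.ofCore core
  let i2 : NormedSpace ℝ Y := NormedSpace.ofCore core
  have hn : ∀ x, ‖L x‖ = p x := fun x => by
    show p (L.symm (L x)) = p x
    rw [L.symm_apply_apply]
  let e : X ≃L[ℝ] Y := L.toContinuousLinearEquivOfBounds C c⁻¹ (fun x => (hn x).trans_le (hp x).2)
    fun y => by
      rw [inv_mul_eq_div, le_div_iff₀' hc]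
      exact (hp _).1
  exact ⟨Y, i1, i2,
    (completeSpace_congr (e := e.toEquiv) e.isUniformEmbedding).mp inferInstance, e, hn⟩

end Renorming

section NormAttaining

theorem abs_add_abs_le_of_clampOne_sum_eq_zero {X : Type*} [NormedAddCommGroup X]
    [NormedSpace ℝ X] {v : ℕ → X →L[ℝ] ℝ}
    (hv : ∀ x y, LinearIndependent ℝ ![x, y] → ∃ n, 1 ≤ v n x ∧ 1 ≤ v n y)
    {x₁ x₂ x₃ : X} {a₁ a₂ a₃ : ℝ} (h₁ : a₁ ≠ 0) (h₂ : a₂ ≠ 0)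
    (hx : LinearIndependent ℝ ![x₁, x₂])
    (h : ∀ n, a₁ * clampOne (v n x₁) + a₂ * clampOne (v n x₂) + a₃ * clampOne (v n x₃) = 0) :
    |a₁| + |a₂| ≤ |a₃| := by
  have hsign : ∀ a : ℝ, a ≠ 0 → ∃ s : ℝ, s ≠ 0 ∧ a * s = |a| ∧
      ∀ t, 1 ≤ s * t → clampOne t = s := by
    intro a ha
    rcases ha.lt_or_gt with h | h
    · refine ⟨-1, by norm_num, by rw [abs_of_neg h]; ring, fun t ht => ?_⟩
      have := clampOne_of_one_le ht
      rw [neg_one_mul, clampOne_neg] at this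
      linarith
    · exact ⟨1, one_ne_zero, by rw [abs_of_pos h, mul_one], fun t ht =>
        clampOne_of_one_le (by linarith)⟩
  obtain ⟨s₁, hs₁, e₁, k₁⟩ := hsign a₁ h₁
  obtain ⟨s₂, hs₂, e₂, k₂⟩ := hsign a₂ h₂
  obtain ⟨n, hn₁, hn₂⟩ := hv (s₁ • x₁) (s₂ • x₂) (by
    rw [LinearIndependent.pair_iff] at hx ⊢
    intro s t hst
    rw [smul_smul, smul_smul] at hst
    simpa [hs₁, hs₂] using hx _ _ hst)
  rw [map_smul, smul_eq_mul] at hn₁ hn₂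
  have := h n
  rw [k₁ _ hn₁, k₂ _ hn₂, e₁, e₂] at this
  have h3 : |a₃ * clampOne (v n x₃)| ≤ |a₃| := by
    rw [abs_mul]
    exact mul_le_of_le_one_right (abs_nonneg _) (abs_clampOne_le _)
  have := (abs_le.mp h3).1
  linarith

variable {H X : Type*} [NormedAddCommGroup H] [InnerProductSpace ℝ H] [NormedAddCommGroup X]
    [NormedSpace ℝ X]

theorem RenormingData.clampOne_sum_eq_zero (d : RenormingData H X) {x : Fin 3 → X}
    {D : Fin 3 → X → ℝ} {a : Fin 3 → ℝ}
    (hD : ∀ i, ∀ᶠ k in atTop, |D i (d.e k) -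
      d.ε (Nat.unpair k).1 * clampOne (d.v (Nat.unpair k).1 (x i)) * (1 / 2) ^ k| ≤ (1 / 4) ^ k)
    (ha : ∀ y, ∑ i, a i * D i y = 0) (n : ℕ) : ∑ i, a i * clampOne (d.v n (x i)) = 0 := by
  have hpair : Tendsto (fun l => Nat.pair n l) atTop atTop :=
    tendsto_atTop_mono (Nat.right_le_pair n) tendsto_id
  have hlim : Tendsto (fun l => (∑ i, |a i|) * (1 / 2 : ℝ) ^ (Nat.pair n l)) atTop (𝓝 0) := by
    simpa using ((tendsto_pow_atTop_nhds_zero_of_lt_one (r := (1 / 2 : ℝ)) (by norm_num)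
      (by norm_num)).comp hpair).const_mul (∑ i, |a i|)
  have hle : d.ε n * |∑ i, a i * clampOne (d.v n (x i))| ≤ 0 := by
    refine ge_of_tendsto hlim ?_
    filter_upwards [hpair.eventually (eventually_all.mpr hD)] with l hl
    simp only [Nat.unpair_pair] at hl
    set k := Nat.pair n l
    have hp : (0 : ℝ) < (1 / 2) ^ k := by positivity
    refine le_of_mul_le_mul_right ?_ hp
    have h4 : ((1 : ℝ) / 4) ^ k = (1 / 2) ^ k * (1 / 2) ^ k := by
      rw [← mul_pow]; norm_num
    calc d.ε n * |∑ i, a i * clampOne (d.v n (x i))| * (1 / 2) ^ k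
        = |∑ i, a i * (D i (d.e k) - d.ε n * clampOne (d.v n (x i)) * (1 / 2) ^ k)| := by
          have e1 : ∑ i, a i * (D i (d.e k) - d.ε n * clampOne (d.v n (x i)) * (1 / 2) ^ k) =
              -(d.ε n * (1 / 2) ^ k * ∑ i, a i * clampOne (d.v n (x i))) := by
            simp only [mul_sub, Finset.sum_sub_distrib, ha, zero_sub, Finset.mul_sum]
            congr 1
            exact Finset.sum_congr rfl fun i _ => by ring
          rw [e1, abs_neg, abs_mul, abs_of_pos (mul_pos (d.ε_pos n) hp)]
          ring
      _ ≤ ∑ i, |a i| * (1 / 4) ^ k := by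
          refine (Finset.abs_sum_le_sum_abs _ _).trans (Finset.sum_le_sum fun i _ => ?_)
          rw [abs_mul]
          exact mul_le_mul_of_nonneg_left (hl i) (abs_nonneg _)
      _ = _ := by rw [← Finset.sum_mul, h4, mul_assoc]
  have h0 : |∑ i, a i * clampOne (d.v n (x i))| ≤ 0 :=
    nonpos_of_mul_nonpos_right hle (d.ε_pos n)
  exact abs_nonpos_iff.mp h0

/-- Functionals attaining their norm at a point are proportional to the derivative of `Φ`. -/
theorem RenormingData.exists_forall_eq_mul_of_abs_apply_eq_norm (d : RenormingData H X)
    {Y : Type*} [NormedAddCommGroup Y] [NormedSpace ℝ Y] (e : X ≃L[ℝ] Y)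
    (h_le : ∀ x, d.Φ x ≤ 1 → ‖e x‖ ≤ 1) (h_eq : ∀ x, ‖e x‖ = 1 → d.Φ x = 1) {x : X}
    (hx : ‖e x‖ = 1) :
    ∃ D : X → ℝ, (∀ᶠ k in atTop, |D (d.e k) -
      d.ε (Nat.unpair k).1 * clampOne (d.v (Nat.unpair k).1 x) * (1 / 2) ^ k| ≤ (1 / 4) ^ k) ∧
      ∀ h : Y →L[ℝ] ℝ, h ≠ 0 → |h (e x)| = ‖h‖ → ∃ μ ≠ 0, ∀ y, h (e y) = μ * D y := by
  obtain ⟨D, hD, hDe⟩ := d.exists_hasLineDerivAt_Φ x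
  refine ⟨D, hDe, fun h hh hat => ?_⟩
  have hpos : 0 < ‖h‖ := norm_pos_iff.mpr hh
  have hne : h (e x) ≠ 0 := by
    intro h0
    rw [h0, abs_zero] at hat
    linarith
  obtain ⟨σ, hσ, hσx⟩ : ∃ σ : ℝ, |σ| = 1 ∧ σ * h (e x) = |h (e x)| := by
    rcases le_total 0 (h (e x)) with h0 | h0
    · exact ⟨1, abs_one, by rw [abs_of_nonneg h0, one_mul]⟩
    · exact ⟨-1, by simp, by rw [abs_of_nonpos h0, neg_one_mul]⟩
  have hσ0 : σ ≠ 0 := by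
    rintro rfl
    simp at hσ
  have hmax : ∀ z, d.Φ z ≤ d.Φ x →
      (σ • (h : Y →ₗ[ℝ] ℝ) ∘ₗ (e : X →ₗ[ℝ] Y)) z ≤ (σ • (h : Y →ₗ[ℝ] ℝ) ∘ₗ (e : X →ₗ[ℝ] Y)) x := by
    intro z hz
    rw [h_eq x hx] at hz
    show σ * h (e z) ≤ σ * h (e x)
    rw [hσx, hat]
    calc σ * h (e z) ≤ |σ * h (e z)| := le_abs_self _
      _ = ‖h (e z)‖ := by rw [abs_mul, hσ, one_mul, Real.norm_eq_abs]
      _ ≤ ‖h‖ * 1 := h.le_of_opNorm_le_of_le le_rfl (h_le z hz)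
      _ = ‖h‖ := mul_one _
  obtain ⟨hDx, hall⟩ := LinearMap.mul_lineDeriv_eq_of_isMaxOn_sublevel d.convexOn_Φ hD
    (by rw [d.Φ_zero, h_eq x hx]; exact one_pos) hmax
  refine ⟨h (e x) / D x, div_ne_zero hne hDx.ne', fun y => ?_⟩
  have h1 : σ * h (e y) * D x = σ * h (e x) * D y := hall y
  rw [div_mul_eq_mul_div, eq_div_iff hDx.ne']
  refine mul_left_cancel₀ hσ0 ?_
  linarith

/-- In the renormed space no three pairwise independent norm-attaining functionals are
linearly dependent. -/
theorem RenormingData.false_of_sum_eq_zero (d : RenormingData H X)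
    (hv : ∀ x y, LinearIndependent ℝ ![x, y] → ∃ n, 1 ≤ d.v n x ∧ 1 ≤ d.v n y)
    {Y : Type*} [NormedAddCommGroup Y] [NormedSpace ℝ Y] (e : X ≃L[ℝ] Y)
    (h_le : ∀ x, d.Φ x ≤ 1 → ‖e x‖ ≤ 1) (h_eq : ∀ x, ‖e x‖ = 1 → d.Φ x = 1)
    {h : Fin 3 → Y →L[ℝ] ℝ} (hh : ∀ i, ∃ y, ‖y‖ = 1 ∧ |h i y| = ‖h i‖)
    (hind : ∀ i j, i ≠ j → LinearIndependent ℝ ![h i, h j])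
    {c : Fin 3 → ℝ} (hc : ∀ i, c i ≠ 0) (hsum : ∑ i, c i • h i = 0) : False := by
  have h0 : ∀ i, h i ≠ 0 := fun i => by
    have := (hind i (i + 1) (by fin_cases i <;> decide)).ne_zero 0
    simpa using this
  choose y hy hyat using hh
  set x : Fin 3 → X := fun i => e.symm (y i) with hxdef
  have hex : ∀ i, e (x i) = y i := fun i => e.apply_symm_apply _
  have hx1 : ∀ i, ‖e (x i)‖ = 1 := fun i => by rw [hex, hy]
  choose D hDe hD using fun i =>
    d.exists_forall_eq_mul_of_abs_apply_eq_norm e h_le h_eq (hx1 i)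
  choose μ hμ hμD using fun i => hD i (h i) (h0 i) (by rw [hex, hyat])
  have hxind : ∀ i j, i ≠ j → LinearIndependent ℝ ![x i, x j] := by
    intro i j hij
    by_contra hdep
    have hxi : x i ≠ 0 := fun h' => by
      have := hx1 i
      rw [h', map_zero, norm_zero] at this
      exact zero_ne_one this
    rw [LinearIndependent.pair_iff' hxi] at hdep
    push Not at hdep
    obtain ⟨s, hs⟩ := hdep
    have hs1 : |s| = 1 := by
      have := hx1 j
      rwa [← hs, map_smul, norm_smul, hx1 i, mul_one] at this
    obtain ⟨ν, hν, hνD⟩ := hD i (h j) (h0 j) (by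
      rw [← hyat j, ← hex j, ← hs, map_smul, map_smul, smul_eq_mul, abs_mul, hs1, one_mul])
    have := (LinearIndependent.pair_iff.mp (hind i j hij) ν (-μ i) (by
      ext z
      have e1 := hμD i (e.symm z)
      have e2 := hνD (e.symm z)
      rw [e.apply_symm_apply] at e1 e2
      show ν * h i z + -μ i * h j z = 0
      rw [e1, e2]
      ring)).1
    exact hν this
  have hzero := d.clampOne_sum_eq_zero (x := x) (D := D) (a := fun i => c i * μ i) hDe fun z => by
    have := congrArg (fun f : Y →L[ℝ] ℝ => f (e z)) hsum
    simp only [sum_apply, smul_apply, smul_eq_mul,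
      hμD, zero_apply] at this
    simpa only [mul_assoc] using this
  have ha : ∀ i, c i * μ i ≠ 0 := fun i => mul_ne_zero (hc i) (hμ i)
  simp only [Fin.sum_univ_three] at hzero
  have i1 := abs_add_abs_le_of_clampOne_sum_eq_zero hv (ha 0) (ha 1)
    (hxind 0 1 (by decide)) hzero
  have i2 := abs_add_abs_le_of_clampOne_sum_eq_zero hv (ha 1) (ha 2) (a₃ := c 0 * μ 0) (x₃ := x 0)
    (hxind 1 2 (by decide)) fun n => by linarith [hzero n]
  have := abs_pos.mpr (ha 1)
  linarith

end NormAttaining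

theorem exists_renormingData {X : Type*} [NormedAddCommGroup X] [NormedSpace ℝ X]
    [CompleteSpace X] [TopologicalSpace.SeparableSpace X]
    (S : ZeroAtInftyContinuousMap ℕ ℝ →L[ℝ] X) {c : ℝ} (hc : 0 < c)
    (hS : ∀ u, c * ‖u‖ ≤ ‖S u‖) :
    ∃ d : RenormingData (lp (fun _ : ℕ => ℝ) 2) X,
      ∀ x y, LinearIndependent ℝ ![x, y] → ∃ n, 1 ≤ d.v n x ∧ 1 ≤ d.v n y := by
  obtain ⟨T, hT⟩ := exists_hilbert_denseRange X
  obtain ⟨r, hr⟩ := exists_seq_forall_linearIndependent_pair (X := X)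
  obtain ⟨a, A, hAa, hA, ha⟩ := exists_biorthogonal_of_embedding S hc hS
  let ε : ℕ → ℝ := fun m => (1 / 2) ^ m / (1 + ‖r m‖)
  have hε : ∀ m, 0 < ε m := fun m => by positivity
  have hle : ∀ m, ε m * (1 + ‖r m‖) = (1 / 2) ^ m := fun m =>
    div_mul_cancel₀ _ (by positivity)
  have hgeom : Summable fun m : ℕ => (1 / 2 : ℝ) ^ m := summable_geometric_two
  have hεr : Summable fun m => ε m * ‖r m‖ := by
    refine hgeom.of_nonneg_of_le (fun m => mul_nonneg (hε m).le (norm_nonneg _)) fun m => ?_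
    have := hle m
    linarith [hε m]
  have hεs : Summable ε := by
    refine hgeom.of_nonneg_of_le (fun m => (hε m).le) fun m => ?_
    have := hle m
    linarith [mul_nonneg (hε m).le (norm_nonneg (r m))]
  obtain ⟨e, E, C, hEe, hE, hE0, he, hre⟩ :=
    exists_biorthogonal_tendsto_zero hAa hA ha (fun m => (hε m).le) hεr
  obtain ⟨w, hw, hwe⟩ := exists_functionals_apply_eq_ite hEe hE
  refine ⟨{
    T := T, e := e, E := E, r := r, w := w, ε := ε, C := C, M := ‖S‖
    denseRange_T := hT
    E_e := hEe
    norm_E_le := hE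
    tendsto_E := hE0
    norm_linearCombination_le := he
    ε_pos := hε
    summable_ε_r := hεr
    summable_ε_w := (hεs.mul_right (2 * C)).of_nonneg_of_le
      (fun m => mul_nonneg (hε m).le (norm_nonneg _))
      fun m => mul_le_mul_of_nonneg_left (hw m) (hε m).le
    tsum_r_e_le := hre
    w_e := hwe }, fun x y hxy => ?_⟩
  obtain ⟨n, hnx, hny⟩ := hr x y hxy (1 + 2 * C * (‖x‖ + ‖y‖))
  have hwn : ∀ z, |w n z| ≤ 2 * C * ‖z‖ := fun z => (w n).le_of_opNorm_le (hw n) z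
  have hC : 0 ≤ 2 * C := (norm_nonneg _).trans (hw n)
  have hx := mul_nonneg hC (norm_nonneg x)
  have hy := mul_nonneg hC (norm_nonneg y)
  refine ⟨n, ?_, ?_⟩
  · show 1 ≤ r n x + w n x
    linarith [(abs_le.mp (hwn x)).1]
  · show 1 ≤ r n y + w n y
    linarith [(abs_le.mp (hwn y)).1]

theorem not_normAttaining_of_renormingData {H X Y : Type*} [NormedAddCommGroup H]
    [InnerProductSpace ℝ H] [NormedAddCommGroup X] [NormedSpace ℝ X] [NormedAddCommGroup Y]
    [NormedSpace ℝ Y] (d : RenormingData H X)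
    (hv : ∀ x y, LinearIndependent ℝ ![x, y] → ∃ n, 1 ≤ d.v n x ∧ 1 ≤ d.v n y)
    (e : X ≃L[ℝ] Y) (h_le : ∀ x, d.Φ x ≤ 1 → ‖e x‖ ≤ 1) (h_eq : ∀ x, ‖e x‖ = 1 → d.Φ x = 1)
    {f g : Y →L[ℝ] ℝ} (hf : ∃ y, ‖y‖ = 1 ∧ |f y| = ‖f‖) (hg : ∃ y, ‖y‖ = 1 ∧ |g y| = ‖g‖)
    (hfg : LinearIndependent ℝ ![f, g]) {t : ℝ} (ht : 0 < t) (ht1 : t < 1) :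
    ¬ ∃ y, ‖y‖ = 1 ∧ |(t • f + (1 - t) • g) y| = ‖t • f + (1 - t) • g‖ := by
  intro hy
  have ht0 : t ≠ 0 := ht.ne'
  have ht1' : 1 - t ≠ 0 := by linarith
  have ht1'' : t - 1 ≠ 0 := by linarith
  have hfg' := LinearIndependent.pair_iff.mp hfg
  have hpair : ∀ a b a' b' : ℝ, a * b' - b * a' ≠ 0 →
      LinearIndependent ℝ ![a • f + b • g, a' • f + b' • g] := by
    intro a b a' b' hdet
    rw [LinearIndependent.pair_iff]
    intro s s' hs
    obtain ⟨h1, h2⟩ := hfg' (s * a + s' * a') (s * b + s' * b') (by rw [← hs]; module)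
    constructor
    · refine (mul_eq_zero.mp (?_ : s * (a * b' - b * a') = 0)).resolve_right hdet
      linear_combination b' * h1 - a' * h2
    · refine (mul_eq_zero.mp (?_ : s' * (a * b' - b * a') = 0)).resolve_right hdet
      linear_combination a * h2 - b * h1
  have hcomb : ∀ i : Fin 3, ![f, g, t • f + (1 - t) • g] i =
      (![1, 0, t] i : ℝ) • f + (![0, 1, 1 - t] i : ℝ) • g := by
    intro i
    fin_cases i <;> simp
  have hdet : ∀ i j : Fin 3, i ≠ j →
      (![1, 0, t] i : ℝ) * ![0, 1, 1 - t] j - ![0, 1, 1 - t] i * ![1, 0, t] j ≠ 0 := by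
    intro i j hij
    fin_cases i <;> fin_cases j <;> first
      | exact absurd rfl hij
      | simp [ht0, ht1', ht1'']
  refine d.false_of_sum_eq_zero hv e h_le h_eq (h := ![f, g, t • f + (1 - t) • g])
    (c := ![t, 1 - t, -1]) ?_ ?_ ?_ ?_
  · intro i
    fin_cases i
    exacts [hf, hg, hy]
  · intro i j hij
    rw [hcomb i, hcomb j]
    exact hpair _ _ _ _ (hdet i j hij)
  · intro i
    fin_cases i <;> simp [ht0, ht1']
  · rw [Fin.sum_univ_three]
    show t • f + (1 - t) • g + (-1 : ℝ) • (t • f + (1 - t) • g) = 0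
    module

end

/-- Let `X` be an infinite-dimensional real Banach space which (i) is weakly compactly
generated, (ii) contains an isomorphic copy of `c₀`, and (iii) is isomorphic to a subspace
of `ℓ∞`. Then `X` admits an equivalent renorming, i.e. there are a Banach space `X'` and a
linear homeomorphism `X ≃L X'`, such that whenever `f, g ∈ NA(X', ℝ)` are linearly
independent and `0 < t < 1`, the functional `t • f + (1 - t) • g` is not norm-attaining. -/
theorem statement6 (X : Type*) [NormedAddCommGroup X] [NormedSpace ℝ X] [CompleteSpace X]
    (hinf : ¬ FiniteDimensional ℝ X)
    -- (i) weakly compactly generated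
    (K : Set X) (hK : IsCompact (toWeakSpace ℝ X '' K))
    (hKgen : Dense (Submodule.span ℝ K : Set X))
    -- (ii) contains an isomorphic copy of c₀
    (S : ZeroAtInftyContinuousMap ℕ ℝ →L[ℝ] X) (c : ℝ) (hc : 0 < c)
    (hS : ∀ u : ZeroAtInftyContinuousMap ℕ ℝ, c * ‖u‖ ≤ ‖S u‖)
    -- (iii) isomorphic to a subspace of ℓ∞
    (J : X →L[ℝ] lp (fun _ : ℕ => ℝ) ∞) (c' : ℝ) (hc' : 0 < c')
    (hJ : ∀ x : X, c' * ‖x‖ ≤ ‖J x‖) :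
    ∃ (X' : Type _) (_ : NormedAddCommGroup X') (_ : NormedSpace ℝ X') (_ : CompleteSpace X'),
      Nonempty (X ≃L[ℝ] X') ∧
      ∀ f g : X' →L[ℝ] ℝ,
        (∃ x : X', ‖x‖ = 1 ∧ |f x| = ‖f‖) →
        (∃ x : X', ‖x‖ = 1 ∧ |g x| = ‖g‖) →
        LinearIndependent ℝ ![f, g] →
        ∀ t : ℝ, 0 < t → t < 1 →
          ¬ ∃ x : X', ‖x‖ = 1 ∧ |(t • f + (1 - t) • g) x| = ‖t • f + (1 - t) • g‖ := by
  have hJinj : Function.Injective J := by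
    rw [injective_iff_map_eq_zero]
    intro x hx
    have h := hJ x
    rw [hx, norm_zero] at h
    exact norm_le_zero_iff.mp (nonpos_of_mul_nonpos_right h hc')
  have hsep : TopologicalSpace.SeparableSpace X :=
    separableSpace_of_isCompact_toWeakSpace_image hK hKgen
      (l := fun n => (lp.evalCLM ℝ (fun _ : ℕ => ℝ) ∞ n).comp J) fun x hx =>
        hJinj (by
          rw [map_zero]
          exact lp.ext (funext fun n => hx n))
  obtain ⟨d, hd⟩ := exists_renormingData S hc hS
  obtain ⟨p, ⟨a, ha, C, hp⟩, h_le, h_eq⟩ := exists_seminorm_of_convexOn d.convexOn_Φ d.Φ_neg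
    d.exists_Φ_le_one_of_norm_le d.exists_norm_le_of_Φ_le_one fun x => by
      obtain ⟨D, hD, -⟩ := d.exists_hasLineDerivAt_Φ x
      exact (hD x).continuousAt
  obtain ⟨X', i₁, i₂, i₃, e, he⟩ := exists_continuousLinearEquiv_norm_eq
    ((LinearEquiv.ofInjective (J : X →ₗ[ℝ] lp (fun _ : ℕ => ℝ) ∞) hJinj).trans
      ULift.moduleEquiv.symm) p ha hp
  refine ⟨X', i₁, i₂, i₃, ⟨e⟩, ?_⟩
  intro f g hf hg hfg t ht ht1
  exact not_normAttaining_of_renormingData d hd e (fun x hx => (he x).trans_le (h_le x hx))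
    (fun x hx => h_eq x ((he x).symm.trans hx)) hf hg hfg ht ht1
end

section
/- There exists an infinite-dimensional real Banach space X such that (i) whenever f, g ∈ NA(X,ℝ) are linearly independent and 0 < t < 1, the functional t·f + (1−t)·g is not norm-attaining, and (ii) for every closed linear subspace M of X with dim(X/M) = 2 there exist x₁, x₂ ∈ X such that the set {x ∈ X : ‖x‖ ≤ 1 and ‖π_M(x)‖_{X/M} = 1} is contained in {x₁, x₂, −x₁, −x₂}, where π_M : X → X/M is the quotient map and X/M carries the quotient norm. -/
open Filter Topology Set
open scoped ZeroAtInfty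

/-- A definite seminorm on a real vector space is the norm of an isomorphic normed space. -/
theorem Seminorm.exists_normedSpace {E : Type} [AddCommGroup E] [Module ℝ E] (p : Seminorm ℝ E)
    (hp : ∀ x, p x = 0 → x = 0) :
    ∃ (X : Type) (_ : NormedAddCommGroup X) (_ : NormedSpace ℝ X) (e : X ≃ₗ[ℝ] E),
      ∀ x, ‖x‖ = p (e x) := by
  let : Norm E := ⟨p⟩
  have core : NormedSpace.Core ℝ E :=
    { norm_nonneg := fun x => apply_nonneg p x
      norm_smul := fun c x => map_smul_eq_mul p c x
      norm_triangle := fun x y => map_add_le_add p x y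
      norm_eq_zero_iff := fun x => ⟨hp x, fun h => h ▸ map_zero p⟩ }
  let := NormedAddCommGroup.ofCore core
  let := NormedSpace.ofCore core
  exact ⟨E, inferInstance, inferInstance, LinearEquiv.refl ℝ E, fun x => rfl⟩

/-- A closed bounded symmetric convex neighbourhood of zero in a Banach space is the closed unit
ball of an equivalent norm. -/
theorem Convex.exists_banachSpace_closedBall {E : Type} [NormedAddCommGroup E] [NormedSpace ℝ E]
    [CompleteSpace E] {B : Set E} (hc : Convex ℝ B) (hcl : IsClosed B) (hsymm : ∀ x ∈ B, -x ∈ B)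
    {r R : ℝ} (hr : 0 < r) (hR : 0 < R) (hrB : Metric.ball 0 r ⊆ B)
    (hBR : B ⊆ Metric.closedBall 0 R) :
    ∃ (X : Type) (_ : NormedAddCommGroup X) (_ : NormedSpace ℝ X) (_ : CompleteSpace X)
      (e : X ≃ₗ[ℝ] E), ∀ x, ‖x‖ ≤ 1 ↔ e x ∈ B := by
  have hnhds : B ∈ 𝓝 (0 : E) := mem_of_superset (Metric.ball_mem_nhds 0 hr) hrB
  have habs : Absorbent ℝ B := absorbent_nhds_zero hnhds
  have hbal : Balanced ℝ B := (balanced_iff_neg_mem hc).2 fun {x} hx => hsymm x hx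
  have hupper : ∀ x, ‖x‖ ≤ R * gauge B x := fun x => by
    have := le_gauge_of_subset_closedBall habs hR.le hBR (x := x)
    rwa [div_le_iff₀' hR] at this
  have hlower : ∀ x, gauge B x ≤ r⁻¹ * ‖x‖ := fun x => by
    rw [inv_mul_eq_div, le_div_iff₀' hr]
    exact mul_gauge_le_norm hrB
  obtain ⟨X, i₁, i₂, e, he⟩ := (gaugeSeminorm hbal hc habs).exists_normedSpace fun x hx => by
    have := hupper x
    rw [gaugeSeminorm_toFun] at hx
    rw [hx, mul_zero] at this
    exact norm_le_zero_iff.1 this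
  simp only [gaugeSeminorm_toFun] at he
  let e' : X ≃L[ℝ] E := e.toContinuousLinearEquivOfBounds R r⁻¹
    (fun x => by rw [he]; exact hupper _) (fun x => by rw [he]; simpa using hlower x)
  refine ⟨X, i₁, i₂, ?_, e, fun x => ?_⟩
  · exact (completeSpace_congr (e := e.toEquiv) e'.isUniformEmbedding).2 inferInstance
  · rw [he, gauge_le_one_iff_mem_closure hc hnhds, hcl.closure_eq]

/-- A linear functional attaining its maximum over a sublevel set of `Φ` at a point `x` is
proportional to the directional derivative of `Φ` at `x`. -/
theorem LinearMap.mul_eq_mul_of_isMaxOn_sublevel {E : Type*} [AddCommGroup E] [Module ℝ E]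
    {Φ : E → ℝ} {f G : E →ₗ[ℝ] ℝ} {x : E} {m : ℝ}
    (hG : ∀ v, HasDerivAt (fun t : ℝ => Φ (x + t • v)) (G v) 0) (hGx : 0 < G x) (hx : Φ x ≤ m)
    (hf : ∀ w, Φ w ≤ m → f w ≤ f x) (v : E) : f v * G x = f x * G v := by
  have hneg : ∀ v, G v < 0 → f v ≤ 0 := fun v hv => by
    have hslope := (hasDerivAt_iff_tendsto_slope.1 (hG v)).eventually (gt_mem_nhds hv)
    have h' : ∀ᶠ t : ℝ in 𝓝[>] 0, slope (fun t : ℝ => Φ (x + t • v)) 0 t < 0 :=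
      nhdsWithin_mono _ (fun t ht => ne_of_gt ht) hslope
    obtain ⟨t, ht, ht0⟩ := (h'.and self_mem_nhdsWithin).exists
    have ht0 : 0 < t := ht0
    simp only [slope_def_field, sub_zero, zero_smul, add_zero] at ht
    rw [div_lt_iff₀ ht0, zero_mul, sub_neg] at ht
    have := hf _ (ht.le.trans hx)
    rw [map_add, map_smul, smul_eq_mul] at this
    nlinarith
  have hker : ∀ v, G v = 0 → f v ≤ 0 := fun v hv => by
    refine le_of_forall_pos_le_add fun ε hε => ?_
    have h1 : ∀ δ : ℝ, 0 < δ → f v ≤ δ * f x := fun δ hδ => by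
      have := hneg (v - δ • x) (by
        rw [map_sub, map_smul, hv, smul_eq_mul]; nlinarith)
      rw [map_sub, map_smul, smul_eq_mul] at this
      linarith
    have h2 := h1 (ε / (|f x| + 1)) (by positivity)
    have h3 : ε / (|f x| + 1) * f x ≤ ε := by
      rw [div_mul_eq_mul_div, div_le_iff₀ (by positivity)]
      nlinarith [le_abs_self (f x)]
    linarith
  have h0 : G (v - (G v / G x) • x) = 0 := by
    rw [map_sub, map_smul, smul_eq_mul]; field_simp; ring
  have h1 := hker _ h0
  have h2 := hker (-(v - (G v / G x) • x)) (by rw [map_neg, h0, neg_zero])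
  rw [map_neg] at h2
  have h3 : f (v - (G v / G x) • x) = 0 := by linarith
  rw [map_sub, map_smul, smul_eq_mul, sub_eq_zero] at h3
  rw [h3]; field_simp

section

variable {X : Type*} [NormedAddCommGroup X] [NormedSpace ℝ X] {J : X → X →ₗ[ℝ] ℝ}

/-- If norm-attaining functionals are determined up to a scalar by the points where they attain
their norm, through a map `J` whose values at any three points, pairwise distinct up to sign, are
linearly independent, then no interior point of a segment between two linearly independent
norm-attaining functionals is norm-attaining. -/
theorem not_normAttaining_segment
    (hJ : ∀ (f : X →L[ℝ] ℝ) (x : X), f ≠ 0 → ‖x‖ ≤ 1 → |f x| = ‖f‖ →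
      ∃ s : ℝ, s ≠ 0 ∧ ∀ v, f v = s * J x v)
    (hind : ∀ x y z : X, x ≠ 0 → y ≠ 0 → z ≠ 0 → ∀ a b c : ℝ,
      (∀ v, a * J x v + b * J y v + c * J z v = 0) →
      (y = x ∨ y = -x) ∨ (z = x ∨ z = -x) ∨ (z = y ∨ z = -y) ∨ (a = 0 ∧ b = 0 ∧ c = 0))
    {f g : X →L[ℝ] ℝ} (hf : ∃ x : X, ‖x‖ = 1 ∧ |f x| = ‖f‖) (hg : ∃ x : X, ‖x‖ = 1 ∧ |g x| = ‖g‖)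
    (hfg : LinearIndependent ℝ ![f, g]) {t : ℝ} (ht0 : 0 < t) (ht1 : t < 1) :
    ¬ ∃ x : X, ‖x‖ = 1 ∧ |(t • f + (1 - t) • g) x| = ‖t • f + (1 - t) • g‖ := by
  rintro ⟨z, hz, hhz⟩
  obtain ⟨x, hx, hfx⟩ := hf
  obtain ⟨y, hy, hgy⟩ := hg
  set h := t • f + (1 - t) • g with hh
  rw [LinearIndependent.pair_iff] at hfg
  have hf0 : f ≠ 0 := fun h0 => by simpa using hfg 1 0 (by simp [h0])
  have hg0 : g ≠ 0 := fun h0 => by simpa using hfg 0 1 (by simp [h0])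
  have hh0 : h ≠ 0 := fun h0 => ht0.ne' (hfg _ _ h0).1
  have hne : ∀ w : X, ‖w‖ = 1 → w ≠ 0 := fun w hw => norm_ne_zero_iff.1 (by simp [hw])
  have hpm : ∀ (k : X →L[ℝ] ℝ) (u w : X), (w = u ∨ w = -u) → |k w| = ‖k‖ → |k u| = ‖k‖ := by
    rintro k u w (rfl | rfl) hk
    · exact hk
    · simpa using hk
  obtain ⟨s, hs, hsf⟩ := hJ f x hf0 hx.le hfx
  obtain ⟨s', hs', hsg⟩ := hJ g y hg0 hy.le hgy
  obtain ⟨r, hr, hrh⟩ := hJ h z hh0 hz.le hhz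
  have hhv : ∀ v, h v = t * f v + (1 - t) * g v := fun v => by simp [hh]
  rcases hind x y z (hne x hx) (hne y hy) (hne z hz) (t * s) ((1 - t) * s') (-r) (fun v => by
    have := hhv v
    rw [hrh, hsf, hsg] at this
    linear_combination -this) with h1 | h1 | h1 | h1
  · obtain ⟨q, hq, hqg⟩ := hJ g x hg0 hx.le (hpm g x y h1 hgy)
    refine hq (hfg q (-s) ?_).1
    ext v
    simp only [add_apply, smul_apply, smul_eq_mul, hsf v,
      hqg v, zero_apply]
    ring
  · obtain ⟨q, hq, hqh⟩ := hJ h x hh0 hx.le (hpm h x z h1 hhz)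
    have := (hfg (s * t - q) (s * (1 - t)) (by
      ext v
      have h2 := hhv v
      rw [hqh, hsf] at h2
      simp only [add_apply, smul_apply, smul_eq_mul, hsf v,
        zero_apply]
      linear_combination -s * h2)).2
    exact mul_ne_zero hs (by linarith) this
  · obtain ⟨q, hq, hqh⟩ := hJ h y hh0 hy.le (hpm h y z h1 hhz)
    have := (hfg (s' * t) (s' * (1 - t) - q) (by
      ext v
      have h2 := hhv v
      rw [hqh, hsg] at h2
      simp only [add_apply, smul_apply, smul_eq_mul, hsg v,
        zero_apply]
      linear_combination -s' * h2)).1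
    exact mul_ne_zero hs' ht0.ne' this
  · exact hr (neg_eq_zero.1 h1.2.2)

/-- Under the assumptions of `not_normAttaining_segment`, the points of the closed unit ball whose
class modulo a closed subspace of codimension two has norm one are at most two up to sign. -/
theorem exists_subset_of_finrank_quotient_eq_two
    (hJ : ∀ (f : X →L[ℝ] ℝ) (x : X), f ≠ 0 → ‖x‖ ≤ 1 → |f x| = ‖f‖ →
      ∃ s : ℝ, s ≠ 0 ∧ ∀ v, f v = s * J x v)
    (hind : ∀ x y z : X, x ≠ 0 → y ≠ 0 → z ≠ 0 → ∀ a b c : ℝ,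
      (∀ v, a * J x v + b * J y v + c * J z v = 0) →
      (y = x ∨ y = -x) ∨ (z = x ∨ z = -x) ∨ (z = y ∨ z = -y) ∨ (a = 0 ∧ b = 0 ∧ c = 0))
    {M : Submodule ℝ X} (hM : IsClosed (M : Set X)) (hdim : Module.finrank ℝ (X ⧸ M) = 2) :
    ∃ x₁ x₂ : X,
      {x : X | ‖x‖ ≤ 1 ∧ Metric.infDist x (M : Set X) = 1} ⊆ {x₁, x₂, -x₁, -x₂} := by
  set S := {x : X | ‖x‖ ≤ 1 ∧ Metric.infDist x (M : Set X) = 1} with hS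
  have : IsClosed (M : Set X) := hM
  have : IsClosed (M.toAddSubgroup : Set X) := hM
  have : FiniteDimensional ℝ (X ⧸ M) := Module.finite_of_finrank_pos (by omega)
  have hsupp : ∀ x ∈ S, x ≠ 0 ∧ ∃ (φ : Module.Dual ℝ (X ⧸ M)) (s : ℝ), s ≠ 0 ∧
      ∀ v, φ (M.mkQ v) = s * J x v := by
    rintro x ⟨hx, hxM⟩
    have hnorm : ‖M.mkQ x‖ = 1 := by
      rw [← hxM]
      exact QuotientAddGroup.norm_mk (S := M.toAddSubgroup) x
    obtain ⟨φ, hφ, hφx⟩ := exists_dual_vector ℝ (M.mkQ x) (by rw [hnorm]; exact one_ne_zero)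
    have hle : ∀ v, |φ (M.mkQ v)| ≤ 1 * ‖v‖ := fun v =>
      (φ.le_opNorm _).trans (by rw [hφ]; gcongr; exact Submodule.Quotient.norm_mk_le M v)
    let f : X →L[ℝ] ℝ := LinearMap.mkContinuous (φ.toLinearMap ∘ₗ M.mkQ) 1 hle
    have hfv : ∀ v, f v = φ (M.mkQ v) := fun v => rfl
    have hfx : f x = 1 := by rw [hfv, hφx, hnorm]; rfl
    have hf1 : ‖f‖ ≤ 1 := LinearMap.mkContinuous_norm_le _ zero_le_one _
    have hf2 : |f x| = ‖f‖ := by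
      refine le_antisymm ((f.le_opNorm x).trans (mul_le_of_le_one_right (norm_nonneg f) hx)) ?_
      rw [hfx, abs_one]; exact hf1
    have hx0 : x ≠ 0 := fun h => by simp [h] at hfx
    obtain ⟨s, hs, hsv⟩ := hJ f x (fun h => by simp [h] at hfx) hx hf2
    exact ⟨hx0, φ.toLinearMap, s, hs, hsv⟩
  have htriple : ∀ x ∈ S, ∀ y ∈ S, ∀ z ∈ S,
      (y = x ∨ y = -x) ∨ (z = x ∨ z = -x) ∨ (z = y ∨ z = -y) := by
    intro x hx y hy z hz
    obtain ⟨hx0, φ, s, hs, hφ⟩ := hsupp x hx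
    obtain ⟨hy0, φ', s', hs', hφ'⟩ := hsupp y hy
    obtain ⟨hz0, φ'', s'', hs'', hφ''⟩ := hsupp z hz
    have hdep : ¬ LinearIndependent ℝ ![φ, φ', φ''] := fun h => by
      have := h.fintype_card_le_finrank
      rw [Subspace.dual_finrank_eq, hdim] at this
      simp at this
    rw [Fintype.not_linearIndependent_iff] at hdep
    obtain ⟨c, hc, i, hi⟩ := hdep
    simp only [Fin.sum_univ_three, Matrix.cons_val] at hc
    rcases hind x y z hx0 hy0 hz0 (c 0 * s) (c 1 * s') (c 2 * s'') (fun v => by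
      have := LinearMap.congr_fun hc (M.mkQ v)
      simp only [LinearMap.add_apply, LinearMap.smul_apply, smul_eq_mul, hφ, hφ', hφ'',
        LinearMap.zero_apply] at this
      linear_combination this) with h | h | h | ⟨h0, h1, h2⟩
    · exact Or.inl h
    · exact Or.inr (Or.inl h)
    · exact Or.inr (Or.inr h)
    · exfalso
      apply hi
      fin_cases i
      · exact (mul_eq_zero.1 h0).resolve_right hs
      · exact (mul_eq_zero.1 h1).resolve_right hs'
      · exact (mul_eq_zero.1 h2).resolve_right hs''
  rcases S.eq_empty_or_nonempty with hempty | ⟨x₁, hx₁⟩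
  · exact ⟨0, 0, by simp [hempty]⟩
  by_cases hall : ∀ y ∈ S, y = x₁ ∨ y = -x₁
  · refine ⟨x₁, x₁, fun y hy => ?_⟩
    rcases hall y hy with h | h <;> simp [h]
  push Not at hall
  obtain ⟨x₂, hx₂, h1, h2⟩ := hall
  refine ⟨x₁, x₂, fun z hz => ?_⟩
  rcases htriple x₁ hx₁ x₂ hx₂ z hz with (h | h) | (h | h) | (h | h)
  · exact absurd h h1
  · exact absurd h h2
  all_goals simp [h]

end

namespace ZeroAtInftyContinuousMap

theorem abs_apply_le_norm (x : C₀(ℕ, ℝ)) (n : ℕ) : |x n| ≤ ‖x‖ :=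
  x.toBCF.norm_coe_le_norm n

theorem norm_le_of_abs_le {x : C₀(ℕ, ℝ)} {C : ℝ} (hC : 0 ≤ C) (h : ∀ n, |x n| ≤ C) : ‖x‖ ≤ C :=
  (BoundedContinuousFunction.norm_le (f := x.toBCF) hC).2 h

theorem exists_forall_ge_abs_lt (x : C₀(ℕ, ℝ)) {ε : ℝ} (hε : 0 < ε) :
    ∃ N, ∀ n ≥ N, |x n| < ε := by
  have h := x.zero_at_infty'
  rw [cocompact_eq_cofinite, Nat.cofinite_eq_atTop] at h
  have h2 := h.eventually (Metric.ball_mem_nhds 0 hε)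
  obtain ⟨N, hN⟩ := eventually_atTop.1 h2
  exact ⟨N, fun n hn => by simpa using hN n hn⟩

/-- The unit vectors of `c₀`. -/
def single (m : ℕ) : C₀(ℕ, ℝ) where
  toFun := Pi.single m 1
  continuous_toFun := continuous_of_discreteTopology
  zero_at_infty' := by
    rw [cocompact_eq_cofinite, Nat.cofinite_eq_atTop]
    refine tendsto_const_nhds.congr' ?_
    filter_upwards [eventually_gt_atTop m] with n hn
    rw [Pi.single_eq_of_ne hn.ne']

theorem single_apply (m n : ℕ) : single m n = if n = m then 1 else 0 :=
  Pi.single_apply m (1 : ℝ) n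

theorem summable_mul_pow (x : C₀(ℕ, ℝ)) {z : ℝ} (hz : |z| < 1) : Summable fun n => x n * z ^ n := by
  refine Summable.of_norm_bounded ((summable_geometric_of_lt_one (abs_nonneg z) hz).mul_left ‖x‖)
    fun n => ?_
  rw [norm_mul, norm_pow]
  exact mul_le_mul_of_nonneg_right (x.abs_apply_le_norm n) (by positivity)

theorem abs_tsum_mul_pow_le (x : C₀(ℕ, ℝ)) {z : ℝ} (hz : |z| < 1) :
    |∑' n, x n * z ^ n| ≤ ‖x‖ * (1 - |z|)⁻¹ := by
  refine tsum_of_norm_bounded (f := fun n => x n * z ^ n)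
    ((hasSum_geometric_of_lt_one (abs_nonneg z) hz).mul_left ‖x‖) fun n => ?_
  rw [norm_mul, norm_pow]
  exact mul_le_mul_of_nonneg_right (x.abs_apply_le_norm n) (by positivity)

theorem hasFPowerSeriesAt_tsum_mul_pow (x : C₀(ℕ, ℝ)) :
    HasFPowerSeriesAt (fun z : ℝ => ∑' n, x n * z ^ n)
      (FormalMultilinearSeries.ofScalars ℝ (fun n => x n)) 0 := by
  have hr : 0 < (FormalMultilinearSeries.ofScalars ℝ (fun n => x n)).radius := by
    refine lt_of_lt_of_le ?_
      (FormalMultilinearSeries.le_radius_of_bound (r := 1) _ ‖x‖ fun n => ?_)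
    · simp
    · simpa [FormalMultilinearSeries.ofScalars_norm] using x.abs_apply_le_norm n
  have h := (FormalMultilinearSeries.hasFPowerSeriesOnBall _ hr).hasFPowerSeriesAt
  refine h.congr (Eventually.of_forall fun z => ?_)
  simp [FormalMultilinearSeries.sum, mul_comm]

theorem eq_zero_of_frequently_tsum_mul_pow_eq_zero {x : C₀(ℕ, ℝ)}
    (h : ∃ᶠ z : ℝ in 𝓝[≠] 0, ∑' n, x n * z ^ n = 0) : x = 0 := by
  have hx := x.hasFPowerSeriesAt_tsum_mul_pow
  have h0 := hx.locally_zero_iff.1 (hx.analyticAt.frequently_zero_iff_eventually_zero.1 h)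
  rw [FormalMultilinearSeries.ofScalars_series_eq_zero] at h0
  ext n
  exact congrFun h0 n

/-- The value at `2⁻⁽ᵏ⁺¹⁾` of the power series with coefficients in `c₀`. -/
noncomputable def powerEval (k : ℕ) : C₀(ℕ, ℝ) →ₗ[ℝ] ℝ where
  toFun x := ∑' n, x n * ((1 / 2 : ℝ) ^ (k + 1)) ^ n
  map_add' x y := by
    have hz : |(1 / 2 : ℝ) ^ (k + 1)| < 1 := by
      rw [abs_of_pos (by positivity)]; exact pow_lt_one₀ (by norm_num) (by norm_num) (by omega)
    rw [← (x.summable_mul_pow hz).tsum_add (y.summable_mul_pow hz)]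
    simp [add_mul]
  map_smul' c x := by
    simp [mul_assoc, tsum_mul_left]

theorem powerEval_apply (k : ℕ) (x : C₀(ℕ, ℝ)) :
    powerEval k x = ∑' n, x n * ((1 / 2 : ℝ) ^ (k + 1)) ^ n := rfl

theorem powerEval_single (k m : ℕ) : powerEval k (single m) = ((1 / 2 : ℝ) ^ (k + 1)) ^ m := by
  rw [powerEval_apply, tsum_eq_single m (fun n hn => by simp [single_apply, hn])]
  simp [single_apply]

theorem abs_powerEval_le (k : ℕ) (x : C₀(ℕ, ℝ)) : |powerEval k x| ≤ 2 * ‖x‖ := by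
  have h0 : (1 / 2 : ℝ) ^ (k + 1) ≤ 1 / 2 := by
    rw [pow_succ]
    have : (1 / 2 : ℝ) ^ k ≤ 1 := pow_le_one₀ (by norm_num) (by norm_num)
    linarith
  have h1 : |(1 / 2 : ℝ) ^ (k + 1)| ≤ 1 / 2 := by rwa [abs_of_pos (by positivity)]
  refine (x.abs_tsum_mul_pow_le (h1.trans_lt (by norm_num))).trans ?_
  rw [mul_comm]
  gcongr
  rw [inv_le_comm₀ (by linarith) (by norm_num)]
  linarith

theorem tendsto_one_half_pow_succ {u : ℕ → ℕ} (hu : Tendsto u atTop atTop) :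
    Tendsto (fun j => (1 / 2 : ℝ) ^ (u j + 1)) atTop (𝓝[≠] 0) := by
  refine tendsto_nhdsWithin_iff.2 ⟨?_, Eventually.of_forall fun j => ?_⟩
  · exact (tendsto_pow_atTop_nhds_zero_of_lt_one (by norm_num) (by norm_num)).comp
      ((tendsto_add_atTop_nat 1).comp hu)
  · exact (by positivity : (0 : ℝ) < (1 / 2) ^ (u j + 1)).ne'

theorem exists_powerEval_ne_zero {x : C₀(ℕ, ℝ)} (hx : x ≠ 0) : ∃ k, powerEval k x ≠ 0 := by
  by_contra! h
  refine hx (eq_zero_of_frequently_tsum_mul_pow_eq_zero ?_)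
  exact (tendsto_one_half_pow_succ tendsto_id).frequently (Frequently.of_forall fun k => h k)

/-- The exponents `1, 3, 5`, repeated periodically. -/
def oddExp (k : ℕ) : ℕ := 2 * (k % 3) + 1

theorem sq_mul_relations {p q r a b c : ℝ} (h1 : a * p + b * q + c * r = 0)
    (h3 : a * p ^ 3 + b * q ^ 3 + c * r ^ 3 = 0) (h5 : a * p ^ 5 + b * q ^ 5 + c * r ^ 5 = 0) :
    a * (p * ((p - q) * (p + q)) * ((p - r) * (p + r))) = 0 := by
  linear_combination q ^ 2 * r ^ 2 * h1 - (q ^ 2 + r ^ 2) * h3 + h5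

/-- If the values of the power series of `x, y, z` satisfy a linear relation with odd powers
`1, 3, 5`, then its first coefficient vanishes unless two of the points agree up to sign. -/
theorem eq_or_eq_neg_or_eq_zero_of_powerEval_relation {x y z : C₀(ℕ, ℝ)} (hx : x ≠ 0) {a b c : ℝ}
    (h : ∀ k, a * powerEval k x ^ oddExp k + b * powerEval k y ^ oddExp k
      + c * powerEval k z ^ oddExp k = 0) :
    (y = x ∨ y = -x) ∨ (z = x ∨ z = -x) ∨ a = 0 := by
  set P : C₀(ℕ, ℝ) → ℝ → ℝ := fun x z => ∑' n, x n * z ^ n with hP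
  have han : ∀ x, AnalyticAt ℝ (P x) 0 := fun x => x.hasFPowerSeriesAt_tsum_mul_pow.analyticAt
  have hrel : ∀ i < 3, ∀ᶠ t in 𝓝[≠] (0 : ℝ), a * P x t ^ (2 * i + 1) + b * P y t ^ (2 * i + 1)
      + c * P z t ^ (2 * i + 1) = 0 := fun i hi => by
    have hA : AnalyticAt ℝ (fun t => a * P x t ^ (2 * i + 1) + b * P y t ^ (2 * i + 1)
        + c * P z t ^ (2 * i + 1)) 0 :=
      ((analyticAt_const.mul ((han x).pow _)).add (analyticAt_const.mul ((han y).pow _))).add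
        (analyticAt_const.mul ((han z).pow _))
    refine (hA.frequently_zero_iff_eventually_zero.1 ?_).filter_mono nhdsWithin_le_nhds
    have hu : Tendsto (fun j => 3 * j + i) atTop atTop :=
      tendsto_atTop_mono (fun j => show j ≤ 3 * j + i by omega) tendsto_id
    refine (tendsto_one_half_pow_succ hu).frequently (Frequently.of_forall fun j => ?_)
    have := h (3 * j + i)
    rwa [oddExp, show (3 * j + i) % 3 = i by omega] at this
  have hzero : ∀ {w : C₀(ℕ, ℝ)}, w ≠ 0 → ∀ᶠ t in 𝓝[≠] (0 : ℝ), P w t ≠ 0 := fun {w} hw => by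
    by_contra hcon
    simp only [not_eventually, not_not] at hcon
    exact hw (eq_zero_of_frequently_tsum_mul_pow_eq_zero hcon)
  have hadd : ∀ u v : C₀(ℕ, ℝ), ∀ᶠ t in 𝓝[≠] (0 : ℝ),
      P (u + v) t = P u t + P v t ∧ P (u - v) t = P u t - P v t := fun u v => by
    have hball : ∀ᶠ t in 𝓝[≠] (0 : ℝ), |t| < 1 :=
      nhdsWithin_le_nhds ((continuous_abs.tendsto (0 : ℝ)).eventually_lt_const (by simp))
    filter_upwards [hball] with t ht
    constructor
    · simp only [hP]
      rw [← (u.summable_mul_pow ht).tsum_add (v.summable_mul_pow ht)]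
      simp [add_mul]
    · simp only [hP]
      rw [← (u.summable_mul_pow ht).tsum_sub (v.summable_mul_pow ht)]
      simp [sub_mul]
  by_contra! hcon
  obtain ⟨⟨h1, h2⟩, ⟨h3, h4⟩, ha⟩ := hcon
  have key : ∀ᶠ t in 𝓝[≠] (0 : ℝ), False := by
    filter_upwards [hrel 0 (by norm_num), hrel 1 (by norm_num), hrel 2 (by norm_num), hzero hx,
      hzero (sub_ne_zero.2 h1.symm), hzero (fun h => h2 (eq_neg_of_add_eq_zero_right h)),
      hzero (sub_ne_zero.2 h3.symm), hzero (fun h => h4 (eq_neg_of_add_eq_zero_right h)),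
      hadd x y, hadd x z] with t e1 e3 e5 nx n1 n2 n3 n4 hxy hxz
    rw [hxy.2] at n1
    rw [hxy.1] at n2
    rw [hxz.2] at n3
    rw [hxz.1] at n4
    norm_num at e1 e3 e5
    exact mul_ne_zero ha (mul_ne_zero (mul_ne_zero nx (mul_ne_zero n1 n2)) (mul_ne_zero n3 n4))
      (sq_mul_relations e1 e3 e5)
  exact key.exists.elim fun _ h => h

end ZeroAtInftyContinuousMap

/-- A summable sequence is determined by its high-order moments against a geometric sequence. -/
theorem eq_zero_of_tsum_mul_one_half_pow_eq_zero {β : ℕ → ℝ} (hβ : Summable β) {N : ℕ}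
    (h : ∀ m ≥ N, ∑' k, β k * ((1 / 2 : ℝ) ^ (k + 1)) ^ m = 0) (k : ℕ) : β k = 0 := by
  induction k using Nat.strong_induction_on with
  | _ k ih =>
    have hβ' := hβ.abs
    have hbound : ∀ m ≥ N, |β k| ≤ (1 / 2 : ℝ) ^ m * ∑' j, |β j| := fun m hm => by
      set θ : ℕ → ℝ := fun j => ((1 / 2 : ℝ) ^ (j + 1)) ^ m with hθ
      have hθ0 : ∀ j, 0 < θ j := fun j => by positivity
      have hθ1 : ∀ j, θ j ≤ 1 := fun j =>
        pow_le_one₀ (by positivity) (pow_le_one₀ (by norm_num) (by norm_num))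
      have hs : Summable fun j => β j * θ j :=
        Summable.of_norm_bounded hβ' fun j => by
          rw [norm_mul, Real.norm_eq_abs, Real.norm_eq_abs, abs_of_pos (hθ0 j)]
          exact mul_le_of_le_one_right (abs_nonneg _) (hθ1 j)
      have hsplit := hs.tsum_eq_add_tsum_ite k
      rw [h m hm] at hsplit
      have hrest : ‖∑' j, (if j = k then 0 else β j * θ j)‖
          ≤ θ k * ((1 / 2 : ℝ) ^ m * ∑' j, |β j|) := by
        refine tsum_of_norm_bounded ((hβ'.hasSum.mul_left _).mul_left _) fun j => ?_
        rcases lt_trichotomy j k with hj | rfl | hj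
        · rw [if_neg hj.ne, ih j hj]
          simp
        · rw [if_pos rfl, norm_zero]
          positivity
        · rw [if_neg hj.ne', norm_mul, Real.norm_eq_abs, Real.norm_eq_abs, abs_of_pos (hθ0 j),
            mul_comm, ← mul_assoc]
          refine mul_le_mul_of_nonneg_right ?_ (abs_nonneg _)
          simp only [hθ]
          rw [← mul_pow]
          refine pow_le_pow_left₀ (by positivity) ?_ m
          rw [← pow_succ]
          exact pow_le_pow_of_le_one (by norm_num) (by norm_num) (by omega)
      have heq : |β k| * θ k = ‖∑' j, (if j = k then 0 else β j * θ j)‖ := by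
        rw [Real.norm_eq_abs, eq_neg_of_add_eq_zero_right hsplit.symm, abs_neg, abs_mul,
          abs_of_pos (hθ0 k)]
      rw [← heq, mul_comm] at hrest
      exact le_of_mul_le_mul_left hrest (hθ0 k)
    have hlim : Tendsto (fun m : ℕ => (1 / 2 : ℝ) ^ m * ∑' j, |β j|) atTop (𝓝 0) := by
      simpa using (tendsto_pow_atTop_nhds_zero_of_lt_one (r := (1 / 2 : ℝ)) (by norm_num)
        (by norm_num)).mul_const (∑' j, |β j|)
    have := ge_of_tendsto hlim ((eventually_ge_atTop N).mono hbound)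
    exact abs_nonpos_iff.1 this

theorem hasDerivAt_sq_max_zero (s : ℝ) :
    HasDerivAt (fun s : ℝ => max s 0 ^ 2) (2 * max s 0) s := by
  rw [hasDerivAt_iff_isLittleO]
  refine Asymptotics.IsBigO.trans_isLittleO (g := fun t => ‖t - s‖ ^ 2)
    (Asymptotics.isBigO_of_le _ fun t => ?_)
    (Asymptotics.isLittleO_pow_sub_sub s one_lt_two)
  rw [norm_pow, norm_norm, Real.norm_eq_abs, Real.norm_eq_abs, sq_abs, abs_le, smul_eq_mul]
  rcases max_cases t 0 with ⟨h, h'⟩ | ⟨h, h'⟩ <;> rcases max_cases s 0 with ⟨k, k'⟩ | ⟨k, k'⟩ <;>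
    rw [h, k] <;> constructor <;> nlinarith

/-- A convex even `C¹` function vanishing exactly on `[-1, 1]`. -/
noncomputable def bump (t : ℝ) : ℝ := max (t - 1) 0 ^ 2 + max (-t - 1) 0 ^ 2

/-- The derivative of `bump`. -/
noncomputable def bumpDeriv (t : ℝ) : ℝ := 2 * max (t - 1) 0 - 2 * max (-t - 1) 0

theorem bump_nonneg (t : ℝ) : 0 ≤ bump t := by unfold bump; positivity

theorem bump_neg (t : ℝ) : bump (-t) = bump t := by unfold bump; rw [neg_neg, add_comm]

theorem bump_eq_zero {t : ℝ} (ht : |t| ≤ 1) : bump t = 0 := by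
  rw [abs_le] at ht
  rw [bump, max_eq_right (by linarith), max_eq_right (by linarith)]
  norm_num

theorem bumpDeriv_eq_zero {t : ℝ} (ht : |t| ≤ 1) : bumpDeriv t = 0 := by
  rw [abs_le] at ht
  rw [bumpDeriv, max_eq_right (by linarith), max_eq_right (by linarith)]
  norm_num

theorem abs_le_two_of_bump_le_one {t : ℝ} (ht : bump t ≤ 1) : |t| ≤ 2 := by
  unfold bump at ht
  rw [abs_le]
  have h1 := le_max_left (t - 1) 0
  have h2 := le_max_left (-t - 1) 0
  constructor <;> nlinarith [sq_nonneg (max (t - 1) 0), sq_nonneg (max (-t - 1) 0)]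

theorem bumpDeriv_mul_self_nonneg (t : ℝ) : 0 ≤ bumpDeriv t * t := by
  unfold bumpDeriv
  rcases max_cases (t - 1) 0 with ⟨h, h'⟩ | ⟨h, h'⟩ <;>
    rcases max_cases (-t - 1) 0 with ⟨k, k'⟩ | ⟨k, k'⟩ <;> rw [h, k] <;> nlinarith

theorem abs_bumpDeriv_le (t : ℝ) : |bumpDeriv t| ≤ 2 * max (|t| - 1) 0 := by
  unfold bumpDeriv
  have h1 : max (t - 1) 0 ≤ max (|t| - 1) 0 := max_le_max_right 0 (by linarith [le_abs_self t])
  have h2 : max (-t - 1) 0 ≤ max (|t| - 1) 0 := max_le_max_right 0 (by linarith [neg_le_abs t])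
  have h3 := le_max_right (t - 1) 0
  have h4 := le_max_right (-t - 1) 0
  rw [abs_le]
  constructor <;> linarith

theorem hasDerivAt_bump (t : ℝ) : HasDerivAt bump (bumpDeriv t) t := by
  have h1 := (hasDerivAt_sq_max_zero (t - 1)).comp t ((hasDerivAt_id t).sub_const 1)
  have h2 := (hasDerivAt_sq_max_zero (-t - 1)).comp t ((hasDerivAt_neg t).sub_const 1)
  refine (h1.add h2).congr_deriv ?_
  unfold bumpDeriv; ring

theorem convexOn_bump : ConvexOn ℝ univ bump := by
  have hpos : ConvexOn ℝ univ fun s : ℝ => max s 0 ^ 2 :=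
    ((convexOn_id convex_univ).sup (convexOn_const 0 convex_univ)).pow
      (fun s _ => le_max_right s 0) 2
  refine ConvexOn.add ?_ ?_
  · simpa [Function.comp_def, sub_eq_add_neg] using hpos.translate_left (-1)
  · have := (hpos.translate_left (-1)).comp_linearMap (-LinearMap.id)
    simpa [Function.comp_def, sub_eq_add_neg] using this

theorem ConvexOn.tsum {ι E : Type*} [AddCommGroup E] [Module ℝ E] {s : Set E} {F : ι → E → ℝ}
    (hs : Convex ℝ s) (hF : ∀ i, ConvexOn ℝ s (F i)) (hsum : ∀ x ∈ s, Summable fun i => F i x) :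
    ConvexOn ℝ s fun x => ∑' i, F i x := by
  refine ⟨hs, fun x hx y hy a b ha hb hab => ?_⟩
  have hx' := (hsum x hx).mul_left a
  have hy' := (hsum y hy).mul_left b
  simp only [smul_eq_mul]
  rw [← tsum_mul_left, ← tsum_mul_left, ← hx'.tsum_add hy']
  exact (hsum _ (hs hx hy ha hb hab)).tsum_le_tsum (fun i => (hF i).2 hx hy ha hb hab)
    (hx'.add hy')

namespace ZeroAtInftyContinuousMap

theorem summable_of_eq_zero_of_abs_le {F : ℕ → ℝ} (x : C₀(ℕ, ℝ)) (h : ∀ n, |x n| ≤ 1 → F n = 0) :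
    Summable F := by
  obtain ⟨N, hN⟩ := x.exists_forall_ge_abs_lt one_pos
  exact summable_of_ne_finset_zero (s := Finset.range N) fun n hn =>
    h n (hN n (by simpa using hn)).le

theorem summable_one_half_pow_succ_mul {F : ℕ → ℝ} {C : ℝ} (h : ∀ n, |F n| ≤ C) :
    Summable fun n => (1 / 2 : ℝ) ^ (n + 1) * F n := by
  refine Summable.of_norm_bounded (g := fun n => (1 / 2 : ℝ) ^ (n + 1) * C) ?_ fun n => ?_
  · exact ((summable_nat_add_iff 1).2 summable_geometric_two).mul_right C
  · rw [norm_mul, Real.norm_of_nonneg (by positivity)]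
    exact mul_le_mul_of_nonneg_left (h n) (by positivity)

theorem hasSum_one_half_pow_succ : HasSum (fun n : ℕ => (1 / 2 : ℝ) ^ (n + 1)) 1 := by
  simpa [pow_succ] using hasSum_geometric_two.mul_right (1 / 2 : ℝ)

theorem oddExp_le (k : ℕ) : oddExp k ≤ 5 := by unfold oddExp; omega

theorem even_oddExp_add_one (k : ℕ) : Even (oddExp k + 1) := ⟨k % 3 + 1, by unfold oddExp; ring⟩

/-- The part of the derivative of `gaugeFun` that depends on the power series values. -/
noncomputable def seriesDeriv (n : ℕ) (x v : C₀(ℕ, ℝ)) : ℝ :=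
  (oddExp n + 1) * powerEval n x ^ oddExp n * powerEval n v

theorem abs_seriesDeriv_le (n : ℕ) (x v : C₀(ℕ, ℝ)) :
    |seriesDeriv n x v| ≤ 6 * (1 + 2 * ‖x‖) ^ 5 * (2 * ‖v‖) := by
  have hx := abs_powerEval_le n x
  have hv := abs_powerEval_le n v
  have h5 : (oddExp n : ℝ) ≤ 5 := by exact_mod_cast oddExp_le n
  have hpow : |powerEval n x| ^ oddExp n ≤ (1 + 2 * ‖x‖) ^ 5 :=
    (pow_le_pow_left₀ (abs_nonneg _) (by linarith) _).trans
      (pow_le_pow_right₀ (by linarith [norm_nonneg x]) (oddExp_le n))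
  rw [seriesDeriv, abs_mul, abs_mul, abs_pow,
    abs_of_nonneg (by positivity : (0 : ℝ) ≤ oddExp n + 1)]
  gcongr
  linarith

theorem summable_bump (x : C₀(ℕ, ℝ)) : Summable fun n => bump (x n) :=
  x.summable_of_eq_zero_of_abs_le fun _ => bump_eq_zero

theorem summable_bumpDeriv (x v : C₀(ℕ, ℝ)) : Summable fun n => bumpDeriv (x n) * v n :=
  x.summable_of_eq_zero_of_abs_le fun n hn => by rw [bumpDeriv_eq_zero hn, zero_mul]

theorem summable_powerEval (x : C₀(ℕ, ℝ)) :
    Summable fun n => (1 / 2 : ℝ) ^ (n + 1) * powerEval n x ^ (oddExp n + 1) := by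
  refine summable_one_half_pow_succ_mul (C := (1 + 2 * ‖x‖) ^ 6) fun n => ?_
  rw [abs_pow]
  exact (pow_le_pow_left₀ (abs_nonneg _) (by linarith [abs_powerEval_le n x]) _).trans
      (pow_le_pow_right₀ (by linarith [norm_nonneg x]) (Nat.succ_le_succ (oddExp_le n)))

theorem summable_seriesDeriv (x v : C₀(ℕ, ℝ)) :
    Summable fun n => (1 / 2 : ℝ) ^ (n + 1) * seriesDeriv n x v :=
  summable_one_half_pow_succ_mul fun n => abs_seriesDeriv_le n x v

/-- The even convex function on `c₀` whose sublevel set at level one is the new unit ball. -/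
noncomputable def gaugeFun (x : C₀(ℕ, ℝ)) : ℝ :=
  ∑' n, bump (x n) + ∑' n, (1 / 2 : ℝ) ^ (n + 1) * powerEval n x ^ (oddExp n + 1)

/-- The Gâteaux derivative of `gaugeFun`. -/
noncomputable def gaugeDeriv (x : C₀(ℕ, ℝ)) : C₀(ℕ, ℝ) →ₗ[ℝ] ℝ where
  toFun v := ∑' n, bumpDeriv (x n) * v n + ∑' n, (1 / 2 : ℝ) ^ (n + 1) * seriesDeriv n x v
  map_add' v w := by
    have h : ∀ n, (1 / 2 : ℝ) ^ (n + 1) * seriesDeriv n x (v + w) =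
        (1 / 2 : ℝ) ^ (n + 1) * seriesDeriv n x v + (1 / 2 : ℝ) ^ (n + 1) * seriesDeriv n x w :=
      fun n => by simp only [seriesDeriv, map_add]; ring
    simp only [h, add_apply, mul_add]
    rw [(summable_bumpDeriv x v).tsum_add (summable_bumpDeriv x w),
      (summable_seriesDeriv x v).tsum_add (summable_seriesDeriv x w)]
    ring
  map_smul' c v := by
    have h : ∀ n, (1 / 2 : ℝ) ^ (n + 1) * seriesDeriv n x (c • v) =
        c * ((1 / 2 : ℝ) ^ (n + 1) * seriesDeriv n x v) :=
      fun n => by simp only [seriesDeriv, map_smul, smul_eq_mul]; ring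
    simp only [h, smul_apply, smul_eq_mul, mul_left_comm _ c, tsum_mul_left, RingHom.id_apply]
    ring

theorem gaugeDeriv_apply (x v : C₀(ℕ, ℝ)) : gaugeDeriv x v =
    ∑' n, bumpDeriv (x n) * v n + ∑' n, (1 / 2 : ℝ) ^ (n + 1) * seriesDeriv n x v := rfl

theorem gaugeFun_neg (x : C₀(ℕ, ℝ)) : gaugeFun (-x) = gaugeFun x := by
  simp only [gaugeFun, neg_apply, bump_neg, map_neg, (even_oddExp_add_one _).neg_pow]

theorem powerEval_term_nonneg (n : ℕ) (x : C₀(ℕ, ℝ)) :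
    0 ≤ (1 / 2 : ℝ) ^ (n + 1) * powerEval n x ^ (oddExp n + 1) :=
  mul_nonneg (by positivity) ((even_oddExp_add_one n).pow_nonneg _)

theorem convexOn_gaugeFun : ConvexOn ℝ univ gaugeFun := by
  refine ConvexOn.add ?_ ?_
  · refine ConvexOn.tsum convex_univ (fun n => ?_) fun x _ => summable_bump x
    exact ⟨convex_univ, fun x _ y _ a b ha hb hab => by
      simpa using convexOn_bump.2 (mem_univ (x n)) (mem_univ (y n)) ha hb hab⟩
  · refine ConvexOn.tsum convex_univ (fun n => ?_) fun x _ => summable_powerEval x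
    have h := ((even_oddExp_add_one n).convexOn_pow (𝕜 := ℝ)).comp_linearMap (powerEval n)
    rw [preimage_univ] at h
    exact h.smul (by positivity)

theorem gaugeFun_le_one {x : C₀(ℕ, ℝ)} (hx : ‖x‖ ≤ 1 / 2) : gaugeFun x ≤ 1 := by
  have h0 : ∑' n, bump (x n) = 0 := by
    rw [← tsum_zero (β := ℕ)]
    exact tsum_congr fun n => bump_eq_zero ((x.abs_apply_le_norm n).trans (by linarith))
  rw [gaugeFun, h0, zero_add]
  refine ((summable_powerEval x).tsum_le_tsum (fun n => ?_)
    hasSum_one_half_pow_succ.summable).trans_eq hasSum_one_half_pow_succ.tsum_eq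
  refine mul_le_of_le_one_right (by positivity) ((le_abs_self _).trans ?_)
  rw [abs_pow]
  exact pow_le_one₀ (abs_nonneg _) ((abs_powerEval_le n x).trans (by linarith))

theorem norm_le_two_of_gaugeFun_le_one {x : C₀(ℕ, ℝ)} (hx : gaugeFun x ≤ 1) : ‖x‖ ≤ 2 := by
  refine norm_le_of_abs_le zero_le_two fun n => abs_le_two_of_bump_le_one ?_
  have h1 := (summable_bump x).le_tsum n fun j _ => bump_nonneg _
  have h2 : 0 ≤ ∑' n, (1 / 2 : ℝ) ^ (n + 1) * powerEval n x ^ (oddExp n + 1) :=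
    tsum_nonneg fun n => powerEval_term_nonneg n x
  rw [gaugeFun] at hx
  linarith

theorem continuous_gaugeFun : Continuous gaugeFun := by
  rw [← continuousOn_univ]
  refine ((convexOn_gaugeFun.continuousOn_tfae isOpen_univ univ_nonempty).out 3 1).1 ?_
  refine ⟨0, mem_univ _, 1, ?_⟩
  rw [eventually_map]
  filter_upwards [Metric.closedBall_mem_nhds (0 : C₀(ℕ, ℝ)) one_half_pos] with x hx
  exact gaugeFun_le_one (by simpa using hx)

theorem gaugeDeriv_self_pos {x : C₀(ℕ, ℝ)} (hx : x ≠ 0) : 0 < gaugeDeriv x x := by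
  have hterm : ∀ n, (1 / 2 : ℝ) ^ (n + 1) * seriesDeriv n x x =
      (oddExp n + 1) * ((1 / 2 : ℝ) ^ (n + 1) * powerEval n x ^ (oddExp n + 1)) := fun n => by
    rw [seriesDeriv]; ring
  have h1 : 0 ≤ ∑' n, bumpDeriv (x n) * x n := tsum_nonneg fun n => bumpDeriv_mul_self_nonneg _
  obtain ⟨k, hk⟩ := exists_powerEval_ne_zero hx
  have h2 : 0 < ∑' n, (1 / 2 : ℝ) ^ (n + 1) * seriesDeriv n x x := by
    refine (summable_seriesDeriv x x).tsum_pos (fun n => ?_) k ?_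
    · rw [hterm]
      exact mul_nonneg (by positivity) (powerEval_term_nonneg n x)
    · rw [hterm]
      have := (even_oddExp_add_one k).pow_pos hk
      positivity
  rw [gaugeDeriv_apply]
  linarith

theorem hasDerivAt_tsum_bump (x v : C₀(ℕ, ℝ)) :
    HasDerivAt (fun t : ℝ => ∑' n, bump (x n + t * v n)) (∑' n, bumpDeriv (x n) * v n) 0 := by
  have hu : Summable fun n => 2 * max (|x n| + |v n| - 1) 0 * |v n| := by
    obtain ⟨N, hN⟩ := x.exists_forall_ge_abs_lt one_half_pos
    obtain ⟨N', hN'⟩ := v.exists_forall_ge_abs_lt one_half_pos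
    refine summable_of_ne_finset_zero (s := Finset.range (max N N')) fun n hn => ?_
    simp only [Finset.mem_range, not_lt, max_le_iff] at hn
    rw [max_eq_right (by linarith [hN n hn.1, hN' n hn.2])]
    ring
  have hderiv : ∀ n, ∀ t : ℝ, t ∈ Metric.ball (0 : ℝ) 1 →
      HasDerivAt (fun t : ℝ => bump (x n + t * v n)) (bumpDeriv (x n + t * v n) * v n) t := by
    intro n t _
    have h1 : HasDerivAt (fun t : ℝ => x n + t * v n) (v n) t := by
      simpa using ((hasDerivAt_id t).mul_const (v n)).const_add (x n)
    exact (hasDerivAt_bump (x n + t * v n)).comp t h1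
  have hbound : ∀ n, ∀ t : ℝ, t ∈ Metric.ball (0 : ℝ) 1 →
      ‖bumpDeriv (x n + t * v n) * v n‖ ≤ 2 * max (|x n| + |v n| - 1) 0 * |v n| := by
    intro n t ht
    have htle : |t| ≤ 1 := (mem_ball_zero_iff.1 ht).le
    have hle : |x n + t * v n| ≤ |x n| + |v n| := by
      have h2 := abs_add_le (x n) (t * v n)
      rw [abs_mul] at h2
      linarith [mul_le_of_le_one_left (abs_nonneg (v n)) htle]
    rw [norm_mul, Real.norm_eq_abs, Real.norm_eq_abs]
    refine mul_le_mul_of_nonneg_right ((abs_bumpDeriv_le _).trans ?_) (abs_nonneg _)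
    gcongr
  have hzero : Summable fun n => bump (x n + 0 * v n) := by
    simpa only [zero_mul, add_zero] using summable_bump x
  have hball : (0 : ℝ) ∈ Metric.ball (0 : ℝ) 1 := Metric.mem_ball_self one_pos
  have h := hasDerivAt_tsum_of_isPreconnected hu Metric.isOpen_ball
    (convex_ball (0 : ℝ) 1).isPreconnected hderiv hbound hball hzero hball
  simpa only [zero_mul, add_zero] using h

theorem hasDerivAt_tsum_powerEval (x v : C₀(ℕ, ℝ)) :
    HasDerivAt (fun t : ℝ => ∑' n, (1 / 2 : ℝ) ^ (n + 1) * powerEval n (x + t • v) ^ (oddExp n + 1))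
      (∑' n, (1 / 2 : ℝ) ^ (n + 1) * seriesDeriv n x v) 0 := by
  have hu : Summable fun n : ℕ =>
      (1 / 2 : ℝ) ^ (n + 1) * (6 * (1 + 2 * (‖x‖ + ‖v‖)) ^ 5 * (2 * ‖v‖)) :=
    hasSum_one_half_pow_succ.summable.mul_right _
  have hderiv : ∀ n, ∀ t : ℝ, t ∈ Metric.ball (0 : ℝ) 1 →
      HasDerivAt (fun t : ℝ => (1 / 2 : ℝ) ^ (n + 1) * powerEval n (x + t • v) ^ (oddExp n + 1))
        ((1 / 2 : ℝ) ^ (n + 1) * seriesDeriv n (x + t • v) v) t := by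
    intro n t _
    have h1 : HasDerivAt (fun t : ℝ => powerEval n (x + t • v)) (powerEval n v) t := by
      simpa using ((hasDerivAt_id t).mul_const (powerEval n v)).const_add (powerEval n x)
    refine ((h1.pow (oddExp n + 1)).const_mul _).congr_deriv ?_
    simp [seriesDeriv]
  have hbound : ∀ n, ∀ t : ℝ, t ∈ Metric.ball (0 : ℝ) 1 →
      ‖(1 / 2 : ℝ) ^ (n + 1) * seriesDeriv n (x + t • v) v‖ ≤
        (1 / 2 : ℝ) ^ (n + 1) * (6 * (1 + 2 * (‖x‖ + ‖v‖)) ^ 5 * (2 * ‖v‖)) := by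
    intro n t ht
    have htle : ‖t‖ ≤ 1 := (mem_ball_zero_iff.1 ht).le
    have hle : ‖x + t • v‖ ≤ ‖x‖ + ‖v‖ := by
      have h2 := norm_add_le x (t • v)
      rw [norm_smul] at h2
      linarith [mul_le_of_le_one_left (norm_nonneg v) htle]
    rw [norm_mul, Real.norm_of_nonneg (by positivity : (0 : ℝ) ≤ (1 / 2) ^ (n + 1))]
    refine mul_le_mul_of_nonneg_left ((abs_seriesDeriv_le _ _ _).trans ?_) (by positivity)
    gcongr
  have hball : (0 : ℝ) ∈ Metric.ball (0 : ℝ) 1 := Metric.mem_ball_self one_pos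
  have h := hasDerivAt_tsum_of_isPreconnected hu Metric.isOpen_ball
    (convex_ball (0 : ℝ) 1).isPreconnected hderiv hbound hball (summable_powerEval _) hball
  simpa only [zero_smul, add_zero] using h

theorem hasDerivAt_gaugeFun (x v : C₀(ℕ, ℝ)) :
    HasDerivAt (fun t : ℝ => gaugeFun (x + t • v)) (gaugeDeriv x v) 0 :=
  (hasDerivAt_tsum_bump x v).add (hasDerivAt_tsum_powerEval x v)

theorem powerEval_relation_of_gaugeDeriv_relation {x y z : C₀(ℕ, ℝ)} {a b c : ℝ}
    (h : ∀ v, a * gaugeDeriv x v + b * gaugeDeriv y v + c * gaugeDeriv z v = 0) (k : ℕ) :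
    a * powerEval k x ^ oddExp k + b * powerEval k y ^ oddExp k
      + c * powerEval k z ^ oddExp k = 0 := by
  obtain ⟨N₁, hx⟩ := x.exists_forall_ge_abs_lt one_pos
  obtain ⟨N₂, hy⟩ := y.exists_forall_ge_abs_lt one_pos
  obtain ⟨N₃, hz⟩ := z.exists_forall_ge_abs_lt one_pos
  have htail : ∀ w : C₀(ℕ, ℝ), ∀ m, |w m| < 1 → gaugeDeriv w (single m) =
      ∑' n, (1 / 2 : ℝ) ^ (n + 1) * seriesDeriv n w (single m) := fun w m hm => by
    rw [gaugeDeriv_apply, tsum_eq_single m (fun n hn => by simp [single_apply, hn]),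
      bumpDeriv_eq_zero hm.le, zero_mul, zero_add]
  set β : ℕ → ℝ := fun n => a * ((1 / 2 : ℝ) ^ (n + 1) * seriesDeriv n x (single 0))
    + b * ((1 / 2 : ℝ) ^ (n + 1) * seriesDeriv n y (single 0))
    + c * ((1 / 2 : ℝ) ^ (n + 1) * seriesDeriv n z (single 0)) with hβ
  have hsum : ∀ v, Summable fun n => a * ((1 / 2 : ℝ) ^ (n + 1) * seriesDeriv n x v)
      + b * ((1 / 2 : ℝ) ^ (n + 1) * seriesDeriv n y v) := fun v =>
    ((summable_seriesDeriv x v).mul_left a).add ((summable_seriesDeriv y v).mul_left b)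
  have hβs : Summable β := (hsum _).add ((summable_seriesDeriv z _).mul_left c)
  have hβ0 := eq_zero_of_tsum_mul_one_half_pow_eq_zero hβs (N := max N₁ (max N₂ N₃))
    (fun m hm => by
      simp only [ge_iff_le, max_le_iff] at hm
      rw [← h (single m), htail x m (hx m hm.1), htail y m (hy m hm.2.1), htail z m (hz m hm.2.2),
        ← tsum_mul_left, ← tsum_mul_left, ← tsum_mul_left,
        ← ((summable_seriesDeriv x _).mul_left a).tsum_add ((summable_seriesDeriv y _).mul_left b),
        ← (hsum _).tsum_add ((summable_seriesDeriv z _).mul_left c)]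
      refine tsum_congr fun n => ?_
      simp only [hβ, seriesDeriv, powerEval_single, pow_zero]
      ring) k
  have hfac : β k = ((1 / 2 : ℝ) ^ (k + 1) * (oddExp k + 1)) *
      (a * powerEval k x ^ oddExp k + b * powerEval k y ^ oddExp k
        + c * powerEval k z ^ oddExp k) := by
    simp only [hβ, seriesDeriv, powerEval_single, pow_zero]
    ring
  rw [hfac] at hβ0
  exact (mul_eq_zero.1 hβ0).resolve_left (by positivity)

theorem gaugeDeriv_independent {x y z : C₀(ℕ, ℝ)} (hx : x ≠ 0) (hy : y ≠ 0) (hz : z ≠ 0)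
    {a b c : ℝ} (h : ∀ v, a * gaugeDeriv x v + b * gaugeDeriv y v + c * gaugeDeriv z v = 0) :
    (y = x ∨ y = -x) ∨ (z = x ∨ z = -x) ∨ (z = y ∨ z = -y) ∨ (a = 0 ∧ b = 0 ∧ c = 0) := by
  have hrel := powerEval_relation_of_gaugeDeriv_relation h
  have h1 := eq_or_eq_neg_or_eq_zero_of_powerEval_relation (b := b) (c := c) (y := y) (z := z) hx
    hrel
  have h2 := eq_or_eq_neg_or_eq_zero_of_powerEval_relation (a := b) (b := a) (c := c) (y := x)
    (z := z) hy
    (fun k => by linear_combination hrel k)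
  have h3 := eq_or_eq_neg_or_eq_zero_of_powerEval_relation (a := c) (b := a) (c := b) (y := x)
    (z := y) hz
    (fun k => by linear_combination hrel k)
  have hcomm : ∀ u w : C₀(ℕ, ℝ), (u = w ∨ u = -w) → (w = u ∨ w = -u) := by
    rintro u w (rfl | rfl) <;> simp
  rcases h1 with h1 | h1 | ha
  · exact .inl h1
  · exact .inr (.inl h1)
  rcases h2 with h2 | h2 | hb
  · exact .inl (hcomm _ _ h2)
  · exact .inr (.inr (.inl h2))
  rcases h3 with h3 | h3 | hc
  · exact .inr (.inl (hcomm _ _ h3))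
  · exact .inr (.inr (.inl (hcomm _ _ h3)))
  exact .inr (.inr (.inr ⟨ha, hb, hc⟩))

theorem not_finiteDimensional : ¬ FiniteDimensional ℝ C₀(ℕ, ℝ) := fun _ => by
  have hli : LinearIndependent ℝ single := by
    refine linearIndependent_iff'.2 fun s g hg i hi => ?_
    have := DFunLike.congr_fun hg i
    have hcoe : ∀ s : Finset ℕ, (∑ j ∈ s, g j • single j) i = ∑ j ∈ s, g j * single j i := by
      intro s
      induction s using Finset.induction_on with
      | empty => simp
      | insert j s hj ih => rw [Finset.sum_insert hj, Finset.sum_insert hj, add_apply, ih]; simp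
    rw [hcoe] at this
    simpa [single_apply, hi] using this
  have := hli.finite
  exact not_finite ℕ

end ZeroAtInftyContinuousMap

open ZeroAtInftyContinuousMap in
theorem exists_eq_mul_of_abs_eq_norm {X : Type*} [NormedAddCommGroup X] [NormedSpace ℝ X]
    (e : X ≃ₗ[ℝ] C₀(ℕ, ℝ)) (he : ∀ x, ‖x‖ ≤ 1 ↔ gaugeFun (e x) ≤ 1) {f : X →L[ℝ] ℝ} {x : X}
    (hf : f ≠ 0) (hx : ‖x‖ ≤ 1) (hfx : |f x| = ‖f‖) :
    ∃ s : ℝ, s ≠ 0 ∧ ∀ v, f v = s * (gaugeDeriv (e x) ∘ₗ e.toLinearMap) v := by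
  have hfx0 : f x ≠ 0 := by rw [← abs_pos, hfx]; exact norm_pos_iff.2 hf
  have hex : e x ≠ 0 := by
    rw [Ne, LinearEquiv.map_eq_zero_iff]
    rintro rfl
    exact hfx0 (map_zero f)
  have hpos := gaugeDeriv_self_pos hex
  have hmax : ∀ w, gaugeFun w ≤ 1 → |f (e.symm w)| ≤ |f x| := fun w hw => by
    rw [hfx]
    exact f.unit_le_opNorm _ ((he _).2 (by rwa [e.apply_symm_apply]))
  have key := LinearMap.mul_eq_mul_of_isMaxOn_sublevel (Φ := gaugeFun) (m := 1) (x := e x)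
    (f := f x • (f.toLinearMap ∘ₗ e.symm.toLinearMap)) (hasDerivAt_gaugeFun (e x)) hpos
    ((he x).1 hx) fun w hw => by
      simp only [LinearMap.smul_apply, LinearMap.comp_apply, LinearEquiv.coe_coe,
        ContinuousLinearMap.coe_coe, e.symm_apply_apply, smul_eq_mul]
      calc f x * f (e.symm w) ≤ |f x| * |f (e.symm w)| := by
            rw [← abs_mul]; exact le_abs_self _
        _ ≤ |f x| * |f x| := mul_le_mul_of_nonneg_left (hmax w hw) (abs_nonneg _)
        _ = f x * f x := abs_mul_abs_self _
  refine ⟨f x / gaugeDeriv (e x) (e x), div_ne_zero hfx0 hpos.ne', fun v => ?_⟩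
  have h := key (e v)
  simp only [LinearMap.smul_apply, LinearMap.comp_apply, LinearEquiv.coe_coe,
    ContinuousLinearMap.coe_coe, e.symm_apply_apply, smul_eq_mul, mul_assoc] at h
  rw [LinearMap.comp_apply, LinearEquiv.coe_coe, div_mul_eq_mul_div, eq_div_iff hpos.ne']
  exact mul_left_cancel₀ hfx0 h

/-- There is an infinite-dimensional real Banach space `X` such that (i) the norm-attaining
segment property holds, and (ii) for every closed subspace `M` of codimension two there are
`x₁, x₂ ∈ X` such that the set of elements of the closed unit ball whose image in `X / M`
has quotient norm one (i.e. `dist(x, M) = 1`) is contained in `{x₁, x₂, -x₁, -x₂}`. -/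
theorem statement7 :
    ∃ (X : Type) (_ : NormedAddCommGroup X) (_ : NormedSpace ℝ X) (_ : CompleteSpace X),
      ¬ FiniteDimensional ℝ X ∧
      (∀ f g : X →L[ℝ] ℝ,
        (∃ x : X, ‖x‖ = 1 ∧ |f x| = ‖f‖) →
        (∃ x : X, ‖x‖ = 1 ∧ |g x| = ‖g‖) →
        LinearIndependent ℝ ![f, g] →
        ∀ t : ℝ, 0 < t → t < 1 →
          ¬ ∃ x : X, ‖x‖ = 1 ∧ |(t • f + (1 - t) • g) x| = ‖t • f + (1 - t) • g‖) ∧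
      (∀ M : Submodule ℝ X, IsClosed (M : Set X) → Module.finrank ℝ (X ⧸ M) = 2 →
        ∃ x₁ x₂ : X,
          {x : X | ‖x‖ ≤ 1 ∧ Metric.infDist x (M : Set X) = 1} ⊆ {x₁, x₂, -x₁, -x₂}) := by
  have hB : Convex ℝ {x | ZeroAtInftyContinuousMap.gaugeFun x ≤ 1} := by
    simpa using ZeroAtInftyContinuousMap.convexOn_gaugeFun.convex_le 1
  obtain ⟨X, i₁, i₂, i₃, e, he⟩ := hB.exists_banachSpace_closedBall
    (isClosed_le ZeroAtInftyContinuousMap.continuous_gaugeFun continuous_const)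
    (fun x hx => (ZeroAtInftyContinuousMap.gaugeFun_neg x).trans_le hx) one_half_pos two_pos
    (fun x hx => ZeroAtInftyContinuousMap.gaugeFun_le_one (mem_ball_zero_iff.1 hx).le)
    (fun x hx => mem_closedBall_zero_iff.2
      (ZeroAtInftyContinuousMap.norm_le_two_of_gaugeFun_le_one hx))
  let J : X → X →ₗ[ℝ] ℝ := fun x => ZeroAtInftyContinuousMap.gaugeDeriv (e x) ∘ₗ e.toLinearMap
  have hJ : ∀ (f : X →L[ℝ] ℝ) (x : X), f ≠ 0 → ‖x‖ ≤ 1 → |f x| = ‖f‖ →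
      ∃ s : ℝ, s ≠ 0 ∧ ∀ v, f v = s * J x v :=
    fun f x hf hx hfx => exists_eq_mul_of_abs_eq_norm e he hf hx hfx
  have hind : ∀ x y z : X, x ≠ 0 → y ≠ 0 → z ≠ 0 → ∀ a b c : ℝ,
      (∀ v, a * J x v + b * J y v + c * J z v = 0) →
      (y = x ∨ y = -x) ∨ (z = x ∨ z = -x) ∨ (z = y ∨ z = -y) ∨ (a = 0 ∧ b = 0 ∧ c = 0) := by
    intro x y z hx hy hz a b c h
    have h' := ZeroAtInftyContinuousMap.gaugeDeriv_independent (e.map_ne_zero_iff.2 hx)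
      (e.map_ne_zero_iff.2 hy) (e.map_ne_zero_iff.2 hz) (a := a) (b := b) (c := c) fun v => by
        simpa [J] using h (e.symm v)
    simpa only [← map_neg, e.injective.eq_iff] using h'
  refine ⟨X, i₁, i₂, i₃, fun _ => ?_, ?_, ?_⟩
  · exact ZeroAtInftyContinuousMap.not_finiteDimensional e.finiteDimensional
  · intro f g hf hg hfg t ht0 ht1
    exact not_normAttaining_segment hJ hind hf hg hfg ht0 ht1
  · intro M hM hdim
    exact exists_subset_of_finrank_quotient_eq_two hJ hind hM hdim
end
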